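/- Let G be an infinite countable amenable group. For any sequence ε_k > 0 converging to zero and any sequence K_k of finite subsets of G, there exists a primely congruent sequence of finite irreducible tilings T_k of G such that the shapes of T_k are (K_k, ε_k)-invariant and the topological entropy of the associated subshift X_{T_k} is zero, for each k. -/

import Mathlib

open Filter Topology Pointwise ENNReal

/-- A Følner sequence for a group `G`. -/
def IsFolnerSeq (G : Type*) [Group G] (F : ℕ → Finset G) : Prop :=
  (∀ n, (F n).Nonempty) ∧
    ∀ g : G, Filter.Tendsto
      (fun n => ((symmDiff (g • ((F n) : Set G)) ((F n) : Set G)).ncard : ℝ) / (F n).card)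
      Filter.atTop (nhds 0)

/-- A group is amenable if it admits a Følner sequence. -/
def IsAmenable (G : Type*) [Group G] : Prop := ∃ F : ℕ → Finset G, IsFolnerSeq G F

variable {G : Type*} [Group G]

/-- The `K`-boundary of a finite set `A`. -/
def kBoundary (A K : Finset G) : Set G :=
  {g : G | (∃ k ∈ K, k * g ∈ A) ∧ ∃ k ∈ K, k * g ∉ A}

/-- `A` is `(K, δ)`-invariant. -/
def InvariantSet (A K : Finset G) (δ : ℝ) : Prop :=
  ((kBoundary A K).ncard : ℝ) < δ * A.card

/-- A subset of a group is syndetic if finitely many translates cover the group. -/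
def Syndetic (A : Set G) : Prop := ∃ F : Finset G, (F : Set G) * A = Set.univ

/-- A finite tiling of a group `G`: a partition of `G` into right translates of
finitely many finite shapes, each shape containing the identity. -/
structure FiniteTiling (G : Type*) [Group G] where
  tiles : Set (Set G)
  shapes : Finset (Finset G)
  covers : ∀ g : G, ∃! t, t ∈ tiles ∧ g ∈ t
  tile_shape : ∀ t ∈ tiles, ∃ S ∈ shapes, ∃ c : G, t = (S : Set G) * {c}
  one_mem_shape : ∀ S ∈ shapes, (1 : G) ∈ S

/-- The set of centers of a shape `S` in a tiling. -/
def FiniteTiling.center (T : FiniteTiling G) (S : Finset G) : Set G :=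
  {c : G | ((S : Set G) * {c}) ∈ T.tiles}

/-- A finite tiling is irreducible if every sufficiently invariant finite set
contains a tile of every shape. -/
def FiniteTiling.IsIrreducible (T : FiniteTiling G) : Prop :=
  ∃ (T₀ : Finset G) (ε : ℝ), 0 < ε ∧
    ∀ F : Finset G, InvariantSet F T₀ ε →
      ∀ S ∈ T.shapes, ∃ c ∈ T.center S, (S : Set G) * {c} ⊆ (F : Set G)

/-- The shift action of `G` on `A^G`: `(c • x) g = x (g * c)`. -/
def shiftAct {A : Type*} (c : G) (x : G → A) : G → A := fun g => x (g * c)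

instance : TopologicalSpace (Option (Finset G)) := ⊥

open Classical in
/-- The point of `(S(T) ∪ {0})^G` encoding the centers of a tiling. -/
noncomputable def FiniteTiling.point (T : FiniteTiling G) : G → Option (Finset G) :=
  fun g => if h : ∃ S, S ∈ T.shapes ∧ g ∈ T.center S then some h.choose else none

/-- The subshift associated with a finite tiling: the orbit closure of `T.point`. -/
noncomputable def FiniteTiling.subshift (T : FiniteTiling G) : Set (G → Option (Finset G)) :=
  closure (Set.range fun c : G => shiftAct c T.point)

/-- `T₂` is primely congruent with `T₁`: tiles of `T₂` are unions of tiles of `T₁`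
and each shape of `T₂` has a unique master partition by tiles of `T₁`. -/
def PrimelyCongruent (T₁ T₂ : FiniteTiling G) : Prop :=
  (∀ t₁ ∈ T₁.tiles, ∀ t₂ ∈ T₂.tiles, (t₁ ∩ t₂).Nonempty → t₁ ⊆ t₂) ∧
  ∀ S ∈ T₂.shapes, ∀ c c' : G, c ∈ T₂.center S → c' ∈ T₂.center S →
    {u : Set G | ∃ t ∈ T₁.tiles, t ⊆ (S : Set G) * {c} ∧ u = t * {c⁻¹}} =
    {u : Set G | ∃ t ∈ T₁.tiles, t ⊆ (S : Set G) * {c'} ∧ u = t * {c'⁻¹}}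

/-- Number of patterns of a subshift on a finite window `F`. -/
noncomputable def patternCount {A : Type*} (X : Set (G → A)) (F : Finset G) : ℕ :=
  {p : ↑F → A | ∃ x ∈ X, ∀ g : ↑F, x (g : G) = p g}.ncard

section Dim

variable {Y : Type*} [TopologicalSpace Y]

/-- `β` is a finite open cover of the set `X`. -/
def IsOpenCoverOf (X : Set Y) (β : Finset (Set Y)) : Prop :=
  (∀ U ∈ β, IsOpen U) ∧ X ⊆ ⋃ U ∈ β, U

/-- The order of a finite cover on a set `X`. -/
noncomputable def ordOn (X : Set Y) (β : Finset (Set Y)) : ℕ :=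
  ⨆ y : X, ({U : Set Y | U ∈ β ∧ (y : Y) ∈ U}.ncard - 1)

/-- `D(α)`: minimal order among finite open covers of `X` refining `α`. -/
noncomputable def Dcov (X : Set Y) (α : Finset (Set Y)) : ℕ :=
  sInf {n | ∃ β : Finset (Set Y), IsOpenCoverOf X β ∧
    (∀ U ∈ β, ∃ V ∈ α, U ⊆ V) ∧ ordOn X β = n}

/-- The topological (covering) dimension of a subset `X` of a topological space. -/
noncomputable def topDim (X : Set Y) : ℕ∞ :=
  ⨆ α ∈ {α : Finset (Set Y) | IsOpenCoverOf X α}, (Dcov X α : ℕ∞)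

/-- The join `⋁_{g ∈ F} (σ g)⁻¹ α` of the pullbacks of a finite cover along an action. -/
noncomputable def FCover {H : Type*} (σ : H → Y → Y) (F : Finset H) (α : Finset (Set Y)) :
    Finset (Set Y) :=
  letI := Classical.decEq H
  letI := Classical.decEq (Set Y)
  (F.pi fun _ => α).image fun f => ⋂ g, ⋂ (h : g ∈ F), σ g ⁻¹' f g h

/-- Mean topological dimension of `X` with respect to an action `σ` of `G`,
computed along the Følner sequence `Fo`. -/
noncomputable def mdim {H : Type*} (σ : H → Y → Y) (X : Set Y) (Fo : ℕ → Finset H) : ℝ≥0∞ :=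
  ⨆ α ∈ {α : Finset (Set Y) | IsOpenCoverOf X α},
    Filter.limsup
      (fun n => (Dcov X (FCover σ (Fo n) α) : ℝ≥0∞) / ((Fo n).card : ℝ≥0∞))
      Filter.atTop

end Dim

/-- A polyhedron: a finite union of simplices (convex hulls of finite sets) in a
Euclidean space. -/
def IsPolyhedron {N : ℕ} (P : Set (EuclideanSpace ℝ (Fin N))) : Prop :=
  ∃ S : Finset (Finset (EuclideanSpace ℝ (Fin N))),
    P = ⋃ s ∈ S, convexHull ℝ (s : Set (EuclideanSpace ℝ (Fin N)))

/-- The upper (Banach) density of a subset of an amenable group. -/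
noncomputable def upperDensity (G : Type*) [Group G] (J : Set G) : ℝ :=
  sSup {r : ℝ | ∃ Fo : ℕ → Finset G, IsFolnerSeq G Fo ∧
    r = Filter.limsup (fun n => ((J ∩ (Fo n : Set G)).ncard : ℝ) / (Fo n).card) Filter.atTop}

namespace GroupTiling

open scoped Classical

/-- The right translate `S g`. -/
def rt (S : Finset G) (g : G) : Finset G := S.map (mulRightEmbedding g)

@[simp] theorem mem_rt {S : Finset G} {g h : G} : h ∈ rt S g ↔ h * g⁻¹ ∈ S := by
  simp only [rt, Finset.mem_map, mulRightEmbedding_apply]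
  constructor
  · rintro ⟨a, ha, rfl⟩
    simpa using ha
  · intro h'
    exact ⟨_, h', by simp⟩

@[simp] theorem rt_rt (S : Finset G) (g h : G) : rt (rt S g) h = rt S (g * h) := by
  ext x; simp [mul_assoc]

@[simp] theorem rt_one (S : Finset G) : rt S 1 = S := by ext x; simp

@[simp] theorem card_rt (S : Finset G) (g : G) : (rt S g).card = S.card := by simp [rt]

theorem coe_rt (S : Finset G) (g : G) : (rt S g : Set G) = (S : Set G) * {g} := by
  ext x; simp

theorem rt_mono {S T : Finset G} (h : S ⊆ T) (g : G) : rt S g ⊆ rt T g := by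
  intro x; simp only [mem_rt]; apply h

theorem rt_subset_iff {S T : Finset G} {g : G} : rt S g ⊆ T ↔ S ⊆ rt T g⁻¹ := by
  constructor
  · intro h; simpa using rt_mono h g⁻¹
  · intro h; simpa using rt_mono h g

theorem rt_injective (g : G) : Function.Injective (fun S : Finset G => rt S g) := by
  intro S T h
  have := congrArg (fun S => rt S g⁻¹) h
  simpa using this

theorem rt_nonempty {S : Finset G} {g : G} : (rt S g).Nonempty ↔ S.Nonempty := by simp [rt]

/-- The `K`-boundary of `A` as a finite set. -/
noncomputable def bd (A K : Finset G) : Finset G :=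
  (K⁻¹ * A).filter fun g => (∃ k ∈ K, k * g ∈ A) ∧ ∃ k ∈ K, k * g ∉ A

@[simp] theorem mem_bd {A K : Finset G} {g : G} :
    g ∈ bd A K ↔ (∃ k ∈ K, k * g ∈ A) ∧ ∃ k ∈ K, k * g ∉ A := by
  simp only [bd, Finset.mem_filter, and_iff_right_iff_imp, and_imp]
  rintro ⟨k, hk, hg⟩ -
  exact Finset.mem_mul.2 ⟨k⁻¹, by simpa, k * g, hg, by simp⟩

theorem coe_bd (A K : Finset G) : (bd A K : Set G) = kBoundary A K := by
  ext g; simp only [Finset.mem_coe, mem_bd, kBoundary, Set.mem_ofPred_eq]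

theorem inv_iff {A K : Finset G} {δ : ℝ} :
    InvariantSet A K δ ↔ ((bd A K).card : ℝ) < δ * A.card := by
  rw [InvariantSet, ← coe_bd, Set.ncard_coe_finset]

theorem bd_mono {A K K' : Finset G} (h : K ⊆ K') : bd A K ⊆ bd A K' := by
  intro g; simp only [mem_bd]
  rintro ⟨⟨k, hk, h1⟩, k', hk', h2⟩
  exact ⟨⟨k, h hk, h1⟩, k', h hk', h2⟩

theorem inv_mono {A K K' : Finset G} {δ δ' : ℝ} (h : K ⊆ K') (hd : δ' ≤ δ)
    (hA : InvariantSet A K' δ') : InvariantSet A K δ := by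
  rw [inv_iff] at *
  have h1 : ((bd A K).card : ℝ) ≤ (bd A K').card := by
    exact_mod_cast Finset.card_le_card (bd_mono h)
  have h2 : δ' * A.card ≤ δ * A.card := by gcongr
  linarith

theorem inv_nonempty {A K : Finset G} {δ : ℝ} (h : InvariantSet A K δ) : A.Nonempty := by
  rw [inv_iff] at h
  by_contra hA
  rw [Finset.not_nonempty_iff_eq_empty] at hA
  subst hA
  rw [Finset.card_empty, Nat.cast_zero, mul_zero] at h
  exact (Nat.cast_nonneg _).not_gt h

theorem bd_rt (A K : Finset G) (g : G) : bd (rt A g) K = rt (bd A K) g := by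
  ext x; simp [mul_assoc]

@[simp] theorem inv_rt {A K : Finset G} {δ : ℝ} {g : G} :
    InvariantSet (rt A g) K δ ↔ InvariantSet A K δ := by
  simp [inv_iff, bd_rt]

/-- The filter of sufficiently invariant finite sets. -/
def fol (G : Type*) [Group G] : Filter (Finset G) where
  sets := {s | ∃ (K : Finset G) (δ : ℝ), 0 < δ ∧ ∀ F, InvariantSet F K δ → F ∈ s}
  univ_sets := ⟨∅, 1, one_pos, fun _ _ => trivial⟩
  sets_of_superset := by
    rintro s t ⟨K, δ, hδ, h⟩ hst
    exact ⟨K, δ, hδ, fun F hF => hst (h F hF)⟩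
  inter_sets := by
    rintro s t ⟨K, δ, hδ, h⟩ ⟨K', δ', hδ', h'⟩
    refine ⟨K ∪ K', min δ δ', lt_min hδ hδ', fun F hF => ⟨h F ?_, h' F ?_⟩⟩
    · exact inv_mono Finset.subset_union_left (min_le_left _ _) hF
    · exact inv_mono Finset.subset_union_right (min_le_right _ _) hF

theorem eventually_fol {p : Finset G → Prop} : (∀ᶠ F in fol G, p F) ↔
    ∃ (K : Finset G) (δ : ℝ), 0 < δ ∧ ∀ F, InvariantSet F K δ → p F := Iff.rfl

theorem eventually_inv (K : Finset G) {δ : ℝ} (hδ : 0 < δ) :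
    ∀ᶠ F in fol G, InvariantSet F K δ := eventually_fol.2 ⟨K, δ, hδ, fun _ => id⟩

theorem eventually_rt {p : Finset G → Prop} (h : ∀ᶠ F in fol G, p F) :
    ∀ᶠ F in fol G, ∀ g, p (rt F g) := by
  obtain ⟨K, δ, hδ, h⟩ := eventually_fol.1 h
  exact eventually_fol.2 ⟨K, δ, hδ, fun F hF g => h _ (inv_rt.2 hF)⟩

theorem eventually_nonempty : ∀ᶠ F in fol G, F.Nonempty :=
  eventually_fol.2 ⟨∅, 1, one_pos, fun _ => inv_nonempty⟩

theorem tendsto_fol {F : ℕ → Finset G} (hF : IsFolnerSeq G F) : Tendsto F atTop (fol G) := by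
  intro s hs
  obtain ⟨K, δ, hδ, h⟩ := eventually_fol.1 hs
  obtain ⟨hne, hlim⟩ := hF
  have key : ∀ᶠ n in atTop, ∀ k ∈ K, ((symmDiff (k⁻¹ • ((F n) : Set G)) ((F n) : Set G)).ncard : ℝ)
      / (F n).card < δ / (K.card + 1) := by
    rw [Filter.eventually_all_finset]
    intro k _
    exact (hlim k⁻¹).eventually_lt_const (by positivity)
  rw [Filter.mem_map]
  filter_upwards [key] with n hn
  apply h
  have hpos : (0 : ℝ) < (F n).card := by exact_mod_cast (hne n).card_pos
  have hsub : kBoundary (F n) K ⊆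
      ⋃ k ∈ K, symmDiff (k⁻¹ • ((F n) : Set G)) ((F n) : Set G) := by
    rintro g ⟨⟨k, hk, h1⟩, k', hk', h2⟩
    simp only [Set.mem_iUnion, exists_prop]
    by_cases hg : g ∈ F n
    · refine ⟨k', hk', Or.inr ⟨hg, ?_⟩⟩
      rw [Set.mem_smul_set_iff_inv_smul_mem]; simpa using h2
    · refine ⟨k, hk, Or.inl ⟨?_, hg⟩⟩
      rw [Set.mem_smul_set_iff_inv_smul_mem]; simpa using h1
  have hfin : ∀ k : G, (symmDiff (k⁻¹ • ((F n) : Set G)) ((F n) : Set G)).Finite := fun k =>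
    Set.Finite.symmDiff ((F n).finite_toSet.smul_set) (F n).finite_toSet
  have h1 : (kBoundary (F n) K).ncard ≤
      ∑ k ∈ K, (symmDiff (k⁻¹ • ((F n) : Set G)) ((F n) : Set G)).ncard := by
    refine (Set.ncard_le_ncard hsub (K.finite_toSet.biUnion fun k _ => hfin k)).trans ?_
    exact Finset.set_ncard_biUnion_le K _
  have h2 : ((kBoundary (F n) K).ncard : ℝ) ≤ ∑ k ∈ K, δ / (K.card + 1) * (F n).card := by
    refine (Nat.cast_le.2 h1).trans ?_
    push_cast
    refine Finset.sum_le_sum fun k hk => ?_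
    exact ((div_lt_iff₀ hpos).1 (hn k hk)).le
  rw [Finset.sum_const, nsmul_eq_mul] at h2
  refine h2.trans_lt ?_
  rw [← mul_assoc]
  apply mul_lt_mul_of_pos_right _ hpos
  rw [← mul_div_assoc, div_lt_iff₀ (by positivity)]
  nlinarith

theorem fol_neBot (hG : IsAmenable G) : (fol G).NeBot := by
  obtain ⟨F, hF⟩ := hG
  exact (tendsto_fol hF).neBot

theorem eventually_card_mul_le (D : Finset G) {δ : ℝ} (hδ : 0 < δ) :
    ∀ᶠ F in fol G, ((D * F).card : ℝ) ≤ (1 + δ) * F.card := by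
  filter_upwards [eventually_inv ({1} ∪ D⁻¹) hδ] with F hF
  rw [inv_iff] at hF
  have : D * F ⊆ F ∪ bd F ({1} ∪ D⁻¹) := by
    intro x hx
    obtain ⟨d, hd, f, hf, rfl⟩ := Finset.mem_mul.1 hx
    by_cases h : d * f ∈ F
    · exact Finset.mem_union_left _ h
    · refine Finset.mem_union_right _ (mem_bd.2 ⟨⟨d⁻¹, ?_, by simpa⟩, 1, by simp, by simpa⟩)
      simp [hd]
  have h2 : ((D * F).card : ℝ) ≤ F.card + (bd F ({1} ∪ D⁻¹)).card := by
    exact_mod_cast (Finset.card_le_card this).trans (Finset.card_union_le _ _)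
  linarith

theorem eventually_card_leave_le (D : Finset G) {δ : ℝ} (hδ : 0 < δ) :
    ∀ᶠ F in fol G, ((F.filter fun g => ∃ d ∈ D, d * g ∉ F).card : ℝ) ≤ δ * F.card := by
  filter_upwards [eventually_inv (D ∪ {1}) hδ] with F hF
  rw [inv_iff] at hF
  refine le_trans ?_ hF.le
  norm_cast
  apply Finset.card_le_card
  intro g hg
  obtain ⟨hg, d, hd, h⟩ := Finset.mem_filter.1 hg
  exact mem_bd.2 ⟨⟨1, by simp, by simpa⟩, d, by simp [hd], h⟩

theorem eventually_le_card [Infinite G] (n : ℕ) : ∀ᶠ F in fol G, n ≤ F.card := by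
  obtain ⟨D, hD⟩ := Infinite.exists_subset_card_eq G (2 * n)
  filter_upwards [eventually_card_mul_le D one_pos, eventually_nonempty] with F hF hne
  have h1 : D.card ≤ (D * F).card := by
    obtain ⟨f, hf⟩ := hne
    rw [← card_rt D f]
    apply Finset.card_le_card
    intro x hx
    exact Finset.mem_mul.2 ⟨_, mem_rt.1 hx, f, hf, by simp⟩
  have h2 : ((2 * n : ℕ) : ℝ) ≤ (1 + 1) * F.card := by
    rw [← hD]; exact le_trans (by exact_mod_cast h1) hF
  push_cast at h2
  have : (n : ℝ) ≤ F.card := by linarith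
  exact_mod_cast this

/-- A finite set is rigid if it is nonempty and has trivial right stabilizer. -/
def Rigid (S : Finset G) : Prop := S.Nonempty ∧ ∀ h, rt S h = S → h = 1

theorem Rigid.translate {S : Finset G} (hS : Rigid S) (g : G) : Rigid (rt S g) := by
  refine ⟨rt_nonempty.2 hS.1, fun k hk => ?_⟩
  have := hS.2 (g * k * g⁻¹) (by rw [← rt_rt, ← rt_rt, hk]; simp)
  simpa using this

section Counting

variable {Z : Finset G} {I : Finset (Finset G)}

theorem card_stab_sq_le (hI : (I : Set (Finset G)).PairwiseDisjoint id)
    (hZ : ∀ t ∈ I, Disjoint t Z) (hr : ∀ t ∈ I, Rigid t) {h : G} (hh : h ≠ 1) :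
    (I.powerset.filter fun J => rt (Z ∪ J.biUnion id) h = Z ∪ J.biUnion id).card ^ 2
      ≤ 2 ^ I.card := by
  set V := I.powerset.filter fun J => rt (Z ∪ J.biUnion id) h = Z ∪ J.biUnion id with hV
  have hx : ∀ t ∈ I, ∃ x ∈ t, x * h ∉ t := by
    intro t ht
    by_contra! hc
    apply hh
    apply (hr t ht).2
    apply Finset.eq_of_subset_of_card_le _ (by simp)
    intro y hy
    simpa using hc _ (mem_rt.1 hy)
  choose! x hx1 hx2 using hx
  have huniq : ∀ t ∈ I, ∀ s ∈ I, ∀ p, p ∈ t → p ∈ s → t = s := by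
    intro t ht s hs p hpt hps
    by_contra hne
    exact Finset.disjoint_left.1 (hI ht hs hne) hpt hps
  have hmem : ∀ J ⊆ I, ∀ t ∈ I, ∀ p ∈ t, (p ∈ Z ∪ J.biUnion id ↔ t ∈ J) := by
    intro J hJ t ht p hp
    simp only [Finset.mem_union, Finset.mem_biUnion, id]
    constructor
    · rintro (h1 | ⟨s, hs, hps⟩)
      · exact absurd h1 (Finset.disjoint_left.1 (hZ t ht) hp)
      · rwa [huniq t ht s (hJ hs) p hp hps]
    · intro h1; exact Or.inr ⟨t, h1, hp⟩
  have hstep : ∀ J ∈ V, ∀ t ∈ I, (t ∈ J ↔ x t * h ∈ Z ∪ J.biUnion id) := by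
    intro J hJ t ht
    obtain ⟨hJI, hJ⟩ := Finset.mem_filter.1 hJ
    rw [Finset.mem_powerset] at hJI
    rw [← hmem J hJI t ht (x t) (hx1 t ht)]
    conv_rhs => rw [← hJ]
    simp
  obtain ⟨T, hTmem, hTmax⟩ := Finset.exists_max_image
    (I.powerset.filter fun T => ∀ t ∈ T, ∀ s ∈ T, x t * h ∉ s) Finset.card
    ⟨∅, by simp⟩
  obtain ⟨hTI, hT⟩ := Finset.mem_filter.1 hTmem
  rw [Finset.mem_powerset] at hTI
  have hext : ∀ t ∈ I, t ∉ T → ∃ s ∈ T, x t * h ∈ s ∨ x s * h ∈ t := by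
    intro t ht htT
    by_contra! hc
    have := hTmax (insert t T) (Finset.mem_filter.2 ⟨?_, ?_⟩)
    · rw [Finset.card_insert_of_notMem htT] at this; omega
    · rw [Finset.mem_powerset]; exact Finset.insert_subset ht hTI
    · intro a ha b hb
      rcases Finset.mem_insert.1 ha with ha | ha <;> rcases Finset.mem_insert.1 hb with hb | hb
      · rw [ha, hb]; exact hx2 _ ht
      · rw [ha]; exact (hc b hb).1
      · rw [hb]; exact (hc a ha).2
      · exact hT a ha b hb
  have inj1 : Set.InjOn (fun J => J ∩ T) (V : Set (Finset (Finset G))) := by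
    intro J hJ J' hJ' e
    have hJI := Finset.mem_powerset.1 (Finset.mem_filter.1 hJ).1
    have hJI' := Finset.mem_powerset.1 (Finset.mem_filter.1 hJ').1
    have hT' : ∀ t ∈ T, (t ∈ J ↔ t ∈ J') := by
      intro t ht
      have : t ∈ J ∩ T ↔ t ∈ J' ∩ T := by simp only at e; rw [e]
      simpa [ht] using this
    have : ∀ t ∈ I, (t ∈ J ↔ t ∈ J') := by
      intro t ht
      by_cases htT : t ∈ T
      · exact hT' t htT
      obtain ⟨s, hs, h1 | h1⟩ := hext t ht htT
      · rw [hstep J hJ t ht, hstep J' hJ' t ht, hmem J hJI s (hTI hs) _ h1,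
          hmem J' hJI' s (hTI hs) _ h1, hT' s hs]
      · rw [← hmem J hJI t ht _ h1, ← hmem J' hJI' t ht _ h1, ← hstep J hJ s (hTI hs),
          ← hstep J' hJ' s (hTI hs), hT' s hs]
    ext t
    exact ⟨fun h1 => (this t (hJI h1)).1 h1, fun h1 => (this t (hJI' h1)).2 h1⟩
  have inj2 : Set.InjOn (fun J => J \ T) (V : Set (Finset (Finset G))) := by
    intro J hJ J' hJ' e
    have hJI := Finset.mem_powerset.1 (Finset.mem_filter.1 hJ).1
    have hJI' := Finset.mem_powerset.1 (Finset.mem_filter.1 hJ').1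
    have hT' : ∀ t ∉ T, (t ∈ J ↔ t ∈ J') := by
      intro t ht
      have : t ∈ J \ T ↔ t ∈ J' \ T := by simp only at e; rw [e]
      simpa [ht] using this
    have : ∀ t ∈ I, (t ∈ J ↔ t ∈ J') := by
      intro t ht
      by_cases htT : t ∈ T
      swap
      · exact hT' t htT
      rw [hstep J hJ t ht, hstep J' hJ' t ht]
      by_cases hs : ∃ s ∈ I, x t * h ∈ s
      · obtain ⟨s, hs, h1⟩ := hs
        have hsT : s ∉ T := fun hsT => hT t htT s hsT h1
        rw [hmem J hJI s hs _ h1, hmem J' hJI' s hs _ h1, hT' s hsT]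
      · push Not at hs
        simp only [Finset.mem_union, Finset.mem_biUnion, id]
        refine or_congr Iff.rfl ⟨?_, ?_⟩
        · rintro ⟨s, h1, h2⟩; exact absurd h2 (hs s (hJI h1))
        · rintro ⟨s, h1, h2⟩; exact absurd h2 (hs s (hJI' h1))
    ext t
    exact ⟨fun h1 => (this t (hJI h1)).1 h1, fun h1 => (this t (hJI' h1)).2 h1⟩
  have c1 : V.card ≤ 2 ^ T.card := by
    rw [← Finset.card_powerset]
    refine Finset.card_le_card_of_injOn _ ?_ inj1
    intro J _
    simp
  have c2 : V.card ≤ 2 ^ (I \ T).card := by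
    rw [← Finset.card_powerset]
    refine Finset.card_le_card_of_injOn _ ?_ inj2
    intro J hJ
    have hJI := Finset.mem_powerset.1 (Finset.mem_filter.1 hJ).1
    simp only [Finset.coe_powerset, Set.mem_preimage, Set.mem_powerset_iff, Finset.coe_subset]
    exact Finset.sdiff_subset_sdiff hJI le_rfl
  calc V.card ^ 2 = V.card * V.card := sq _
    _ ≤ 2 ^ T.card * 2 ^ (I \ T).card := Nat.mul_le_mul c1 c2
    _ = 2 ^ I.card := by
      rw [← pow_add, add_comm, Finset.card_sdiff_add_card_eq_card hTI]

theorem card_not_rigid_le (hI : (I : Set (Finset G)).PairwiseDisjoint id)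
    (hZ : ∀ t ∈ I, Disjoint t Z) (hr : ∀ t ∈ I, Rigid t) (hne : Z.Nonempty) {m : ℕ}
    (hm : I.card = 2 * m) :
    (I.powerset.filter fun J => ¬ Rigid (Z ∪ J.biUnion id)).card
      ≤ (Z ∪ I.biUnion id).card * 2 ^ m := by
  obtain ⟨z, hz⟩ := hne
  set H := ((Z ∪ I.biUnion id).image (z⁻¹ * ·)).filter (· ≠ 1)
  have hsub : (I.powerset.filter fun J => ¬ Rigid (Z ∪ J.biUnion id)) ⊆
      H.biUnion fun h => I.powerset.filter fun J => rt (Z ∪ J.biUnion id) h = Z ∪ J.biUnion id := by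
    intro J hJ
    obtain ⟨hJI, hJ⟩ := Finset.mem_filter.1 hJ
    have hJI' := Finset.mem_powerset.1 hJI
    have hzJ : z ∈ Z ∪ J.biUnion id := Finset.mem_union_left _ hz
    unfold Rigid at hJ
    push Not at hJ
    obtain ⟨h, h1, h2⟩ := hJ ⟨z, hzJ⟩
    rw [Finset.mem_biUnion]
    refine ⟨h, Finset.mem_filter.2 ⟨Finset.mem_image.2 ⟨z * h, ?_, by simp⟩, h2⟩,
      Finset.mem_filter.2 ⟨hJI, h1⟩⟩
    have : z * h ∈ rt (Z ∪ J.biUnion id) h := by simpa using hzJ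
    rw [h1] at this
    exact Finset.union_subset_union_right (Finset.biUnion_subset_biUnion_of_subset_left _ hJI') this
  refine (Finset.card_le_card hsub).trans
    ((Finset.card_biUnion_le_card_mul _ _ (2 ^ m) ?_).trans ?_)
  · intro h hh
    have := card_stab_sq_le hI hZ hr (Finset.mem_filter.1 hh).2
    rw [hm, mul_comm, pow_mul] at this
    exact (Nat.pow_le_pow_iff_left two_ne_zero).1 this
  · exact Nat.mul_le_mul_right _ ((Finset.card_filter_le _ _).trans Finset.card_image_le)

theorem exists_rigid_pair {Z₁ Z₂ : Finset G} (hI : (I : Set (Finset G)).PairwiseDisjoint id)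
    (hZ₁ : ∀ t ∈ I, Disjoint t Z₁) (hZ₂ : ∀ t ∈ I, Disjoint t Z₂) (hr : ∀ t ∈ I, Rigid t)
    (hne₁ : Z₁.Nonempty) (hne₂ : Z₂.Nonempty) {m : ℕ} (hm : I.card = 2 * m)
    (hlt : (Z₁ ∪ I.biUnion id).card + (Z₂ ∪ I.biUnion id).card < 2 ^ m) :
    ∃ J ⊆ I, Rigid (Z₁ ∪ J.biUnion id) ∧ Rigid (Z₂ ∪ (I \ J).biUnion id) := by
  by_contra! hc
  have h1 := card_not_rigid_le hI hZ₁ hr hne₁ hm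
  have h2 := card_not_rigid_le hI hZ₂ hr hne₂ hm
  set B₁ := I.powerset.filter fun J => ¬ Rigid (Z₁ ∪ J.biUnion id)
  set B₂ := I.powerset.filter fun J => ¬ Rigid (Z₂ ∪ J.biUnion id)
  have hsub : I.powerset ⊆ B₁ ∪ B₂.image (I \ ·) := by
    intro J hJ
    have hJI := Finset.mem_powerset.1 hJ
    by_cases hR : Rigid (Z₁ ∪ J.biUnion id)
    · refine Finset.mem_union_right _ (Finset.mem_image.2 ⟨I \ J, Finset.mem_filter.2
        ⟨Finset.mem_powerset.2 Finset.sdiff_subset, hc J hJI hR⟩, ?_⟩)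
      exact Finset.sdiff_sdiff_eq_self hJI
    · exact Finset.mem_union_left _ (Finset.mem_filter.2 ⟨hJ, hR⟩)
  have h3 := Finset.card_le_card hsub
  rw [Finset.card_powerset, hm] at h3
  have h4 := Finset.card_union_le B₁ (B₂.image (I \ ·))
  have h5 : (B₂.image (I \ ·)).card ≤ B₂.card := Finset.card_image_le
  have h6 : (2 : ℕ) ^ (2 * m) = 2 ^ m * 2 ^ m := by rw [← pow_add]; congr 1; omega
  have h7 : 0 < 2 ^ m := by positivity
  nlinarith

end Counting

/-- A partition of `G` into finite tiles of uniformly bounded extent. -/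
structure Partn (G : Type*) [Group G] where
  tile : G → Finset G
  mem_tile : ∀ g, g ∈ tile g
  tile_eq : ∀ {g h}, h ∈ tile g → tile h = tile g
  bounded : ∃ D : Finset G, ∀ g h, h ∈ tile g → h * g⁻¹ ∈ D

namespace Partn

variable (P Q R : Partn G)

/-- The tile of `g`, translated so that `g` moves to the identity. -/
def shape (g : G) : Finset G := rt (P.tile g) g⁻¹

instance : LE (Partn G) := ⟨fun P Q => ∀ g, P.tile g ⊆ Q.tile g⟩

/-- Unions of tiles. -/
def Sat (A : Finset G) : Prop := ∀ g ∈ A, P.tile g ⊆ A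

/-- All tiles are rigid. -/
def IsRigid : Prop := ∀ g, Rigid (P.tile g)

variable {P Q R}

theorem le_refl (P : Partn G) : P ≤ P := fun _ => subset_rfl

theorem le_trans (h : P ≤ Q) (h' : Q ≤ R) : P ≤ R := fun g => (h g).trans (h' g)

theorem mem_tile_iff {g h : G} : h ∈ P.tile g ↔ P.tile h = P.tile g :=
  ⟨P.tile_eq, fun e => e ▸ P.mem_tile h⟩

theorem tile_eq_or_disjoint (g h : G) : P.tile g = P.tile h ∨ Disjoint (P.tile g) (P.tile h) := by
  by_contra! hc
  obtain ⟨h1, h2⟩ := hc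
  obtain ⟨x, hx, hy⟩ := Finset.not_disjoint_iff.1 h2
  exact h1 ((P.tile_eq hx).symm.trans (P.tile_eq hy))

theorem card_tile_pos (g : G) : 0 < (P.tile g).card := Finset.card_pos.2 ⟨g, P.mem_tile g⟩

theorem exists_card_le (P : Partn G) : ∃ d : ℕ, 0 < d ∧ ∀ g, (P.tile g).card ≤ d := by
  obtain ⟨D, hD⟩ := P.bounded
  have h : ∀ g, (P.tile g).card ≤ D.card := fun g => by
    rw [← card_rt D g]
    exact Finset.card_le_card fun h hh => mem_rt.2 (hD g h hh)
  exact ⟨D.card, (card_tile_pos 1).trans_le (h 1), h⟩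

theorem one_mem_shape (g : G) : 1 ∈ P.shape g := by simp [shape, P.mem_tile]

theorem rt_shape (g : G) : rt (P.shape g) g = P.tile g := by simp [shape]

theorem mem_shape {g h : G} : h ∈ P.shape g ↔ h * g ∈ P.tile g := by simp [shape]

theorem shape_of_mem {g h : G} (hh : h ∈ P.tile g) : P.shape h = rt (P.shape g) (g * h⁻¹) := by
  simp [shape, P.tile_eq hh]

theorem finite_range_shape (P : Partn G) : (Set.range P.shape).Finite := by
  obtain ⟨D, hD⟩ := P.bounded
  refine (D.powerset.finite_toSet).subset ?_
  rintro _ ⟨g, rfl⟩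
  simp only [Finset.coe_powerset, Set.mem_preimage, Set.mem_powerset_iff, Finset.coe_subset]
  intro h hh
  simpa using hD g (h * g) (mem_shape.1 hh)

theorem tile_sat (h : P ≤ Q) (g : G) : P.Sat (Q.tile g) := by
  intro x hx
  rw [← Q.tile_eq hx]
  exact h x

theorem Sat.union {A B : Finset G} (hA : P.Sat A) (hB : P.Sat B) : P.Sat (A ∪ B) := by
  intro g hg
  rcases Finset.mem_union.1 hg with h | h
  · exact (hA g h).trans Finset.subset_union_left
  · exact (hB g h).trans Finset.subset_union_right

theorem Sat.sdiff {A B : Finset G} (hA : P.Sat A) (hB : P.Sat B) : P.Sat (A \ B) := by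
  intro g hg x hx
  obtain ⟨h1, h2⟩ := Finset.mem_sdiff.1 hg
  refine Finset.mem_sdiff.2 ⟨hA g h1 hx, fun hxB => h2 (hB x hxB ?_)⟩
  rw [P.tile_eq hx]; exact P.mem_tile g

theorem Sat.biUnion {ι : Type*} {s : Finset ι} {f : ι → Finset G} (h : ∀ i ∈ s, P.Sat (f i)) :
    P.Sat (s.biUnion f) := by
  intro g hg
  obtain ⟨i, hi, hgi⟩ := Finset.mem_biUnion.1 hg
  exact (h i hi g hgi).trans (Finset.subset_biUnion_of_mem f hi)

theorem Sat.mono {A : Finset G} (h : P ≤ Q) (hA : Q.Sat A) : P.Sat A :=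
  fun g hg => (h g).trans (hA g hg)

theorem sat_tiles {A : Finset G} {I : Finset (Finset G)} (hI : I ⊆ A.image P.tile) :
    P.Sat (I.biUnion id) := by
  apply Sat.biUnion
  intro t ht
  obtain ⟨g, -, rfl⟩ := Finset.mem_image.1 (hI ht)
  exact tile_sat (le_refl P) g

theorem Sat.biUnion_image {A : Finset G} (hA : P.Sat A) : (A.image P.tile).biUnion id = A := by
  ext x
  simp only [Finset.mem_biUnion, Finset.mem_image, id]
  constructor
  · rintro ⟨_, ⟨g, hg, rfl⟩, hx⟩; exact hA g hg hx
  · intro hx; exact ⟨_, ⟨x, hx, rfl⟩, P.mem_tile x⟩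

theorem Sat.biUnion_subset {A : Finset G} (hA : P.Sat A) {I : Finset (Finset G)}
    (hI : I ⊆ A.image P.tile) : I.biUnion id ⊆ A := by
  conv_rhs => rw [← hA.biUnion_image]
  exact Finset.biUnion_subset_biUnion_of_subset_left _ hI

theorem pairwiseDisjoint_image (A : Finset G) :
    ((A.image P.tile : Finset (Finset G)) : Set (Finset G)).PairwiseDisjoint id := by
  intro s hs t ht hne
  obtain ⟨g, -, rfl⟩ := Finset.mem_image.1 (Finset.mem_coe.1 hs)
  obtain ⟨h, -, rfl⟩ := Finset.mem_image.1 (Finset.mem_coe.1 ht)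
  exact (tile_eq_or_disjoint g h).resolve_left hne

theorem exists_few_tiles (P : Partn G) {τ : ℝ} (hτ : 0 < τ) : ∃ n : ℕ, 0 < n ∧ ∀ Y, P.Sat Y →
    n ≤ Y.card → ∃ (m : ℕ) (I : Finset (Finset G)), I ⊆ Y.image P.tile ∧ I.card = 2 * m ∧
      8 * Y.card < 2 ^ m ∧ ((I.biUnion id).card : ℝ) ≤ τ * Y.card ∧
      (Y \ I.biUnion id).Nonempty := by
  obtain ⟨d, hd0, hd⟩ := P.exists_card_le
  set τ' := min τ (1 / 2) with hτ'
  have hτ'0 : 0 < τ' := by positivity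
  have hlim : ∀ᶠ N : ℕ in atTop, (2 * (Nat.log 2 N + 4) * d : ℝ) ≤ τ' * N := by
    have h1 := (Real.isLittleO_log_id_atTop.comp_tendsto tendsto_natCast_atTop_atTop).def
      (c := τ' * Real.log 2 / (4 * d)) (by have := Real.log_pos one_lt_two; positivity)
    filter_upwards [h1, eventually_ge_atTop (Nat.ceil (16 * d / τ')), eventually_ge_atTop 1] with
      N h1 h2 h3
    have h3' : (1 : ℝ) ≤ N := by exact_mod_cast h3
    have h2' : 16 * d / τ' ≤ N := (Nat.le_ceil _).trans (by exact_mod_cast h2)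
    rw [div_le_iff₀ hτ'0] at h2'
    simp only [Function.comp, id, Real.norm_eq_abs] at h1
    rw [abs_of_nonneg (Real.log_nonneg h3'), abs_of_nonneg (by linarith)] at h1
    have h4 : (Nat.log 2 N : ℝ) ≤ Real.log N / Real.log 2 := by
      have := Real.natLog_le_logb N 2
      simpa [Real.logb] using this
    have hl : 0 < Real.log 2 := Real.log_pos one_lt_two
    have h5 : (Nat.log 2 N : ℝ) ≤ τ' / (4 * d) * N := by
      refine h4.trans ?_
      rw [div_le_iff₀ hl]
      calc _ ≤ _ := h1
        _ = _ := by ring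
    have hd' : (0 : ℝ) < d := by exact_mod_cast hd0
    have h6 : (Nat.log 2 N : ℝ) * (4 * d) ≤ τ' * N := by
      have := mul_le_mul_of_nonneg_right h5 (by positivity : (0:ℝ) ≤ 4 * d)
      calc _ ≤ _ := this
        _ = _ := by field_simp
    nlinarith
  obtain ⟨n, hn⟩ := eventually_atTop.1 hlim
  refine ⟨n + 1, by omega, fun Y hY hYn => ?_⟩
  have hN := hn Y.card (by omega)
  set m := Nat.log 2 Y.card + 4 with hm
  have hYpos : (0 : ℝ) < Y.card := by exact_mod_cast (by omega : 0 < Y.card)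
  have hN' : (2 * m * d : ℝ) ≤ τ' * Y.card := by rw [hm]; push_cast; linarith
  have hcard : ∀ I ⊆ Y.image P.tile, (I.biUnion id).card ≤ I.card * d := by
    intro I hI
    refine Finset.card_biUnion_le_card_mul _ _ _ fun t ht => ?_
    obtain ⟨g, -, rfl⟩ := Finset.mem_image.1 (hI ht)
    exact hd g
  have h1 : 2 * m ≤ (Y.image P.tile).card := by
    have h2 := hcard _ subset_rfl
    rw [hY.biUnion_image] at h2
    have h3 : (2 * m * d : ℝ) ≤ Y.card := hN'.trans (by
      have : τ' ≤ 1 / 2 := min_le_right _ _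
      nlinarith)
    have h4 : 2 * m * d ≤ Y.card := by exact_mod_cast h3
    exact Nat.le_of_mul_le_mul_right (h4.trans h2) hd0
  obtain ⟨I, hI, hIc⟩ := Finset.exists_subset_card_eq h1
  have hc := hcard I hI
  have hc' : ((I.biUnion id).card : ℝ) ≤ τ' * Y.card := by
    refine _root_.le_trans (Nat.cast_le.2 hc) ?_
    rw [hIc]; push_cast; exact hN'
  refine ⟨m, I, hI, hIc, ?_, hc'.trans (by gcongr; exact min_le_left _ _), ?_⟩
  · have := Nat.lt_pow_succ_log_self one_lt_two Y.card
    rw [hm, pow_add]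
    rw [pow_succ] at this
    omega
  · rw [← Finset.card_pos]
    have h5 : (I.biUnion id).card < Y.card := by
      have h6 : ((I.biUnion id).card : ℝ) < Y.card := by
        have : τ' ≤ 1 / 2 := min_le_right _ _
        nlinarith
      exact_mod_cast h6
    have := Finset.le_card_sdiff (I.biUnion id) Y
    omega

theorem IsRigid.drop (hP : P.IsRigid) {τ : ℝ} (hτ : 0 < τ) : ∃ n : ℕ, 0 < n ∧ ∀ Y, P.Sat Y →
    n ≤ Y.card → ∃ Y' ⊆ Y, P.Sat Y' ∧ ((Y \ Y').card : ℝ) ≤ τ * Y.card ∧ Rigid Y' := by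
  obtain ⟨n, hn0, hn⟩ := P.exists_few_tiles hτ
  refine ⟨n, hn0, fun Y hY hYn => ?_⟩
  obtain ⟨m, I, hI, hIc, hlt, hsmall, hne⟩ := hn Y hY hYn
  have hdis := (pairwiseDisjoint_image (P := P) Y).subset (Finset.coe_subset.2 hI)
  have hdZ : ∀ t ∈ I, Disjoint t (Y \ I.biUnion id) := fun t ht =>
    Finset.disjoint_sdiff.mono_left (Finset.subset_biUnion_of_mem id ht)
  have hr : ∀ t ∈ I, Rigid t := by
    intro t ht
    obtain ⟨g, -, rfl⟩ := Finset.mem_image.1 (hI ht)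
    exact hP g
  have hIY := hY.biUnion_subset hI
  obtain ⟨J, hJ, hJ1, -⟩ := exists_rigid_pair hdis hdZ hdZ hr hne hne hIc (by
    rw [Finset.sdiff_union_of_subset hIY]; omega)
  have hJsub : J.biUnion id ⊆ I.biUnion id := Finset.biUnion_subset_biUnion_of_subset_left _ hJ
  refine ⟨_, ?_, (hY.sdiff (sat_tiles hI)).union (sat_tiles (hJ.trans hI)), ?_, hJ1⟩
  · exact Finset.union_subset Finset.sdiff_subset (hJsub.trans hIY)
  · refine _root_.le_trans ?_ hsmall
    norm_cast
    apply Finset.card_le_card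
    intro x hx
    simp only [Finset.mem_sdiff, Finset.mem_union] at hx
    tauto

theorem IsRigid.split (hP : P.IsRigid) {τ : ℝ} (hτ : 0 < τ) : ∃ n : ℕ, 0 < n ∧ ∀ Y₁ Y₂,
    P.Sat Y₁ → P.Sat Y₂ → Disjoint Y₁ Y₂ → n ≤ Y₁.card → Y₂.Nonempty → Y₂.card ≤ 3 * Y₁.card →
    ∃ Y' ⊆ Y₁, P.Sat Y' ∧ ((Y₁ \ Y').card : ℝ) ≤ τ * Y₁.card ∧ Rigid Y' ∧
      Rigid (Y₂ ∪ Y₁ \ Y') := by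
  obtain ⟨n, hn0, hn⟩ := P.exists_few_tiles hτ
  refine ⟨n, hn0, fun Y Y₂ hY hY₂ hYY hYn hne₂ hc₂ => ?_⟩
  obtain ⟨m, I, hI, hIc, hlt, hsmall, hne⟩ := hn Y hY hYn
  have hdis := (pairwiseDisjoint_image (P := P) Y).subset (Finset.coe_subset.2 hI)
  have hdZ : ∀ t ∈ I, Disjoint t (Y \ I.biUnion id) := fun t ht =>
    Finset.disjoint_sdiff.mono_left (Finset.subset_biUnion_of_mem id ht)
  have hIY := hY.biUnion_subset hI
  have hdZ₂ : ∀ t ∈ I, Disjoint t Y₂ := fun t ht =>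
    hYY.mono_left ((Finset.subset_biUnion_of_mem id ht).trans hIY)
  have hr : ∀ t ∈ I, Rigid t := by
    intro t ht
    obtain ⟨g, -, rfl⟩ := Finset.mem_image.1 (hI ht)
    exact hP g
  obtain ⟨J, hJ, hJ1, hJ2⟩ := exists_rigid_pair hdis hdZ hdZ₂ hr hne hne₂ hIc (by
    rw [Finset.sdiff_union_of_subset hIY]
    have h1 := Finset.card_union_le Y₂ (I.biUnion id)
    have h2 := Finset.card_le_card hIY
    omega)
  have hJsub : J.biUnion id ⊆ I.biUnion id := Finset.biUnion_subset_biUnion_of_subset_left _ hJ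
  have hdiff : Y \ (Y \ I.biUnion id ∪ J.biUnion id) = (I \ J).biUnion id := by
    ext x
    simp only [Finset.mem_sdiff, Finset.mem_union, Finset.mem_biUnion, id, not_or]
    push Not
    constructor
    · rintro ⟨hx, h1, h2⟩
      obtain ⟨t, ht, hxt⟩ := h1 hx
      exact ⟨t, ⟨ht, fun htJ => h2 t htJ hxt⟩, hxt⟩
    · rintro ⟨t, ⟨ht, htJ⟩, hxt⟩
      refine ⟨hIY (Finset.mem_biUnion.2 ⟨t, ht, hxt⟩), fun _ => ⟨t, ht, hxt⟩, fun s hs hxs => ?_⟩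
      have : s ≠ t := fun e => htJ (e ▸ hs)
      exact Finset.disjoint_left.1 (hdis (hJ hs) ht this) hxs hxt
  refine ⟨_, ?_, (hY.sdiff (sat_tiles hI)).union (sat_tiles (hJ.trans hI)), ?_, hJ1, ?_⟩
  · exact Finset.union_subset Finset.sdiff_subset (hJsub.trans hIY)
  · refine _root_.le_trans ?_ hsmall
    norm_cast
    apply Finset.card_le_card
    rw [hdiff]
    exact Finset.biUnion_subset_biUnion_of_subset_left _ Finset.sdiff_subset
  · rwa [hdiff]

theorem exists_glue {ι : Type*} (P : Partn G) (t : ι → Finset G)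
    (hdis : ∀ i j g, g ∈ t i → g ∈ t j → i = j) (hsat : ∀ i, P.Sat (t i)) (D : Finset G)
    (hD : ∀ i, ∀ g ∈ t i, ∀ h ∈ t i, h * g⁻¹ ∈ D) :
    ∃ Q : Partn G, (∀ i, ∀ g ∈ t i, Q.tile g = t i) ∧
      (∀ g, (∀ i, g ∉ t i) → Q.tile g = P.tile g) := by
  let f : G → Finset G := fun g => if h : ∃ i, g ∈ t i then t h.choose else P.tile g
  have h1 : ∀ i, ∀ g ∈ t i, f g = t i := by
    intro i g hg
    have : ∃ i, g ∈ t i := ⟨i, hg⟩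
    simp only [f, dif_pos this]
    exact congrArg t (hdis _ _ g this.choose_spec hg)
  have h2 : ∀ g, (∀ i, g ∉ t i) → f g = P.tile g := by
    intro g hg
    simp only [f]
    rw [dif_neg (by push Not; exact hg)]
  have h3 : ∀ g, (∃ i, g ∈ t i ∧ f g = t i) ∨ ((∀ i, g ∉ t i) ∧ f g = P.tile g) := by
    intro g
    by_cases h : ∃ i, g ∈ t i
    · obtain ⟨i, hi⟩ := h
      exact Or.inl ⟨i, hi, h1 i g hi⟩
    · push Not at h
      exact Or.inr ⟨h, h2 g h⟩
  obtain ⟨E, hE⟩ := P.bounded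
  refine ⟨⟨f, ?_, ?_, D ∪ E, ?_⟩, h1, h2⟩
  · intro g
    rcases h3 g with ⟨i, hi, e⟩ | ⟨-, e⟩ <;> rw [e]
    · exact hi
    · exact P.mem_tile g
  · intro g h hh
    rcases h3 g with ⟨i, hi, e⟩ | ⟨hg, e⟩ <;> rw [e] at hh ⊢
    · exact h1 i h hh
    · have : ∀ i, h ∉ t i := by
        intro i hi
        refine hg i (hsat i h hi ?_)
        rw [P.tile_eq hh]; exact P.mem_tile g
      rw [h2 h this, P.tile_eq hh]
  · intro g h hh
    rcases h3 g with ⟨i, hi, e⟩ | ⟨hg, e⟩ <;> rw [e] at hh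
    · exact Finset.mem_union_left _ (hD i g hi h hh)
    · exact Finset.mem_union_right _ (hE g h hh)

theorem exists_greedy [Countable G] (P : Partn G) {F : Finset G} (hF : F.Nonempty) {θ τ : ℝ}
    (hθ8 : θ ≤ 1 / 8) (hτ : τ ≤ θ)
    (hdrop : ∀ (x : G) (N : Set G), (∀ g ∈ N, ∀ h ∈ P.tile g, h ∈ N) →
      (((rt F x).filter (· ∈ N)).card : ℝ) ≤ θ * F.card →
      ∃ t ⊆ rt F x, (∀ g ∈ t, g ∉ N) ∧ P.Sat t ∧ Rigid t ∧
        ((((rt F x).filter (· ∉ N)) \ t).card : ℝ) ≤ τ * F.card) :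
    ∃ (t : ℕ → Finset G) (e : ℕ → G), (∀ i j g, g ∈ t i → g ∈ t j → i = j) ∧
      (∀ i, P.Sat (t i)) ∧ (∀ i, t i ⊆ rt F (e i)) ∧
      (∀ i, (t i).Nonempty → Rigid (t i) ∧ (1 - 2 * θ) * F.card ≤ (t i).card ∧
        (((rt F (e i)).filter fun g => ∀ j, g ∉ t j).card : ℝ) ≤ τ * F.card) ∧
      ∀ g, θ * F.card ≤ ((rt F g).filter fun g => ∃ j, g ∈ t j).card := by
  obtain ⟨e, he⟩ := exists_surjective_nat G
  have hFpos : (0 : ℝ) < F.card := by exact_mod_cast hF.card_pos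
  have hstep : ∀ (x : G) (N : Set G), ∃ t : Finset G, (∀ g ∈ N, ∀ h ∈ P.tile g, h ∈ N) →
      (t ⊆ rt F x ∧ (∀ g ∈ t, g ∉ N) ∧ P.Sat t ∧
        (t.Nonempty → Rigid t ∧ (((rt F x).filter (· ∈ N)).card : ℝ) ≤ θ * F.card ∧
          ((((rt F x).filter (· ∉ N)) \ t).card : ℝ) ≤ τ * F.card) ∧
        (t = ∅ → θ * F.card < ((rt F x).filter (· ∈ N)).card)) := by
    intro x N
    by_cases hN : (∀ g ∈ N, ∀ h ∈ P.tile g, h ∈ N)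
    swap
    · exact ⟨∅, fun h => absurd h hN⟩
    by_cases hc : (((rt F x).filter (· ∈ N)).card : ℝ) ≤ θ * F.card
    · obtain ⟨t, h1, h2, h3, h4, h5⟩ := hdrop x N hN hc
      exact ⟨t, fun _ => ⟨h1, h2, h3, fun _ => ⟨h4, hc, h5⟩, fun h => absurd h h4.1.ne_empty⟩⟩
    · refine ⟨∅, fun _ => ⟨by simp, by simp, by simp [Sat], by simp, fun _ => not_le.1 hc⟩⟩
  choose f hf using hstep
  obtain ⟨N, hN0, hNs⟩ : ∃ N : ℕ → Set G, N 0 = ∅ ∧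
      ∀ i, N (i + 1) = N i ∪ (f (e i) (N i) : Set G) :=
    ⟨fun n => Nat.rec ∅ (fun i S => S ∪ (f (e i) S : Set G)) n, rfl, fun _ => rfl⟩
  have hsat : ∀ i, ∀ g ∈ N i, ∀ h ∈ P.tile g, h ∈ N i := by
    intro i
    induction i with
    | zero => intro g hg; simp [hN0] at hg
    | succ i ih =>
      intro g hg h hh
      rw [hNs] at hg ⊢
      rcases hg with hg | hg
      · exact Or.inl (ih g hg h hh)
      · exact Or.inr ((hf (e i) (N i) ih).2.2.1 g hg hh)
  set t : ℕ → Finset G := fun i => f (e i) (N i) with ht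
  have H := fun i => hf (e i) (N i) (hsat i)
  have hNt : ∀ i g, g ∈ N i ↔ ∃ j < i, g ∈ t j := by
    intro i g
    induction i with
    | zero => simp [hN0]
    | succ i ih =>
      rw [hNs, Set.mem_union, ih]
      constructor
      · rintro (⟨j, hj, hg⟩ | hg)
        · exact ⟨j, by omega, hg⟩
        · exact ⟨i, by omega, hg⟩
      · rintro ⟨j, hj, hg⟩
        rcases Nat.lt_succ_iff_lt_or_eq.1 hj with h | rfl
        · exact Or.inl ⟨j, h, hg⟩
        · exact Or.inr hg
  have hlt : ∀ i j g, i < j → g ∈ t i → g ∉ t j := fun i j g hij hg hgj =>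
    (H j).2.1 g hgj ((hNt j g).2 ⟨i, hij, hg⟩)
  have hrest : ∀ i, (t i).Nonempty →
      (((rt F (e i)).filter fun g => ∀ j, g ∉ t j).card : ℝ) ≤ τ * F.card := by
    intro i hi
    refine _root_.le_trans ?_ ((H i).2.2.2.1 hi).2.2
    norm_cast
    apply Finset.card_le_card
    intro g hg
    obtain ⟨h1, h2⟩ := Finset.mem_filter.1 hg
    refine Finset.mem_sdiff.2 ⟨(Finset.mem_filter (p := fun g => g ∉ N i)).2
      ⟨h1, fun h => ?_⟩, h2 i⟩
    obtain ⟨j, -, hj⟩ := (hNt i g).1 h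
    exact h2 j hj
  refine ⟨t, e, ?_, fun i => (H i).2.2.1, fun i => (H i).1, fun i hi => ⟨((H i).2.2.2.1 hi).1, ?_,
    hrest i hi⟩, fun g => ?_⟩
  · intro i j g hi hj
    rcases lt_trichotomy i j with h | rfl | h
    · exact absurd hj (hlt i j g h hi)
    · rfl
    · exact absurd hi (hlt j i g h hj)
  · obtain ⟨-, h1, h2⟩ := (H i).2.2.2.1 hi
    have h3 := Finset.card_filter_add_card_filter_not (s := rt F (e i)) (fun g => g ∈ N i)
    have h4 := Finset.le_card_sdiff (t i) ((rt F (e i)).filter fun g => g ∉ N i)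
    rw [card_rt] at h3
    have h5 : (F.card : ℝ) ≤ ((rt F (e i)).filter (· ∈ N i)).card +
      (((rt F (e i)).filter fun g => g ∉ N i) \ t i).card + (t i).card := by
      norm_cast; omega
    change (((((rt F (e i)).filter fun g => g ∉ N i) \ t i).card : ℕ) : ℝ) ≤ τ * F.card at h2
    nlinarith
  · obtain ⟨i, rfl⟩ := he g
    rcases (t i).eq_empty_or_nonempty with h0 | h0
    · refine ((H i).2.2.2.2 h0).le.trans ?_
      norm_cast
      apply Finset.card_le_card
      intro g hg
      obtain ⟨h1, h2⟩ := Finset.mem_filter.1 hg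
      obtain ⟨j, -, hj⟩ := (hNt i g).1 h2
      exact Finset.mem_filter.2 ⟨h1, j, hj⟩
    · have h1 := hrest i h0
      have h3 := Finset.card_filter_add_card_filter_not (s := rt F (e i)) (fun g => ∃ j, g ∈ t j)
      rw [card_rt] at h3
      push Not at h3
      have h5 : (F.card : ℝ) = ((rt F (e i)).filter fun g => ∃ j, g ∈ t j).card +
        ((rt F (e i)).filter fun g => ∀ j, g ∉ t j).card := by
        exact_mod_cast h3.symm
      nlinarith

end Partn

/-- A set meeting every right translate of `F` in proportion `θ` has lower density `θ`. -/
theorem eventually_density {F : Finset G} (hF : F.Nonempty) {N : Set G} {θ τ : ℝ} (hτ : 0 < τ)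
    (h : ∀ g, θ * F.card ≤ ((rt F g).filter (· ∈ N)).card) :
    ∀ᶠ W in fol G, (θ - τ) * W.card ≤ ((W.filter (· ∈ N)).card : ℝ) := by
  have hFpos : (0 : ℝ) < F.card := by exact_mod_cast hF.card_pos
  filter_upwards [eventually_card_leave_le F hτ] with W hW
  have h1 : ∑ g ∈ W, ((rt F g).filter (· ∈ N)).card
      ≤ F.card * ((W.filter (· ∈ N)).card + (W.filter fun g => ∃ d ∈ F, d * g ∉ W).card) := by
    have e1 : ∀ g, ((rt F g).filter (· ∈ N)).card = ∑ f ∈ F, if f * g ∈ N then 1 else 0 := by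
      intro g
      rw [rt, Finset.filter_map, Finset.card_map, Finset.card_filter]
      rfl
    simp_rw [e1]
    rw [Finset.sum_comm, ← smul_eq_mul, ← Finset.sum_const]
    refine Finset.sum_le_sum fun f hf => ?_
    rw [← Finset.card_filter]
    have : (W.filter fun g => f * g ∈ N) ⊆
        ((W.filter (· ∈ N)).image fun g : G => f⁻¹ * g) ∪
        (W.filter fun g => ∃ d ∈ F, d * g ∉ W) := by
      intro g hg
      obtain ⟨hg, hgN⟩ := Finset.mem_filter.1 hg
      by_cases hW : f * g ∈ W
      · exact Finset.mem_union_left _ (Finset.mem_image.2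
          ⟨f * g, Finset.mem_filter.2 ⟨hW, hgN⟩, by simp⟩)
      · exact Finset.mem_union_right _ (Finset.mem_filter.2 ⟨hg, f, hf, hW⟩)
    refine (Finset.card_le_card this).trans ((Finset.card_union_le _ _).trans ?_)
    exact Nat.add_le_add_right Finset.card_image_le _
  have h2 : ∑ g ∈ W, θ * (F.card : ℝ) ≤ ∑ g ∈ W, (((rt F g).filter (· ∈ N)).card : ℝ) :=
    Finset.sum_le_sum fun g _ => h g
  rw [Finset.sum_const, nsmul_eq_mul] at h2
  have h3 : (∑ g ∈ W, (((rt F g).filter (· ∈ N)).card : ℝ)) ≤ F.card *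
    ((W.filter (· ∈ N)).card + (W.filter fun g => ∃ d ∈ F, d * g ∉ W).card) := by
    exact_mod_cast h1
  have h4 : (F.card : ℝ) * (θ * W.card) ≤ F.card * ((W.filter (· ∈ N)).card + τ * W.card) := by
    calc (F.card : ℝ) * (θ * W.card) = W.card * (θ * F.card) := by ring
      _ ≤ _ := h2.trans h3
      _ ≤ _ := by gcongr
  have := le_of_mul_le_mul_left h4 hFpos
  linarith

theorem exists_card_almost_full_le {α : Type*} {η : ℝ} (hη : 0 < η) : ∃ θ₀ > 0, ∀ θ : ℝ, θ ≤ θ₀ →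
    ∀ F : Finset α, ((F.powerset.filter fun A => ((F \ A).card : ℝ) ≤ 2 * θ * F.card).card : ℝ)
      ≤ Real.exp (η * F.card) := by
  set x := min (η / 2) 1 with hx
  have hx0 : 0 < x := by positivity
  have hx1 : x ≤ 1 := min_le_right _ _
  have hl : 0 ≤ -Real.log x := by have := Real.log_nonpos hx0.le hx1; linarith
  refine ⟨η / 4 / (-Real.log x + 1), by positivity, fun θ hθ F => ?_⟩
  have hθ' : θ * (-Real.log x) ≤ η / 4 := by
    have h1 : θ * (-Real.log x) ≤ η / 4 / (-Real.log x + 1) * (-Real.log x) := by gcongr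
    refine h1.trans ?_
    rw [div_mul_eq_mul_div, div_le_iff₀ (by linarith)]
    nlinarith
  have h1 : ∑ A ∈ F.powerset, x ^ (F.card - A.card) = (1 + x) ^ F.card := by
    rw [← Finset.sum_pow_mul_eq_add_pow]
    simp
  have h2 : ∑ A ∈ F.powerset.filter (fun A => ((F \ A).card : ℝ) ≤ 2 * θ * F.card),
      x ^ (2 * θ * F.card : ℝ) ≤ ∑ A ∈ F.powerset, x ^ (F.card - A.card) := by
    refine le_trans (Finset.sum_le_sum fun A hA => ?_)
      (Finset.sum_le_sum_of_subset_of_nonneg (Finset.filter_subset _ _) fun _ _ _ => by positivity)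
    obtain ⟨hA, hA2⟩ := Finset.mem_filter.1 hA
    rw [← Finset.card_sdiff_of_subset (Finset.mem_powerset.1 hA), ← Real.rpow_natCast]
    exact Real.rpow_le_rpow_of_exponent_ge hx0 hx1 hA2
  rw [Finset.sum_const, nsmul_eq_mul, h1] at h2
  have h3 : (1 + x) ^ F.card ≤ Real.exp (x * F.card) := by
    rw [mul_comm, Real.exp_nat_mul]
    gcongr
    linarith [Real.add_one_le_exp x]
  have h4 : x ^ (2 * θ * F.card : ℝ) = Real.exp (Real.log x * (2 * θ * F.card)) :=
    Real.rpow_def_of_pos hx0 _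
  rw [h4] at h2
  have h5 := h2.trans h3
  rw [← le_div_iff₀ (Real.exp_pos _), ← Real.exp_sub] at h5
  refine h5.trans (Real.exp_le_exp.2 ?_)
  have h6 : x ≤ η / 2 := min_le_left _ _
  have h7 : (0 : ℝ) ≤ F.card := by positivity
  have h8 : x - Real.log x * (2 * θ) ≤ η := by linarith
  nlinarith

/-- The boundary of what is left of `W` after removing a quasi-tiling by subsets of translates
of `F` is small. -/
theorem eventually_card_bd_le {F K : Finset G} (hF : F.Nonempty) {t : ℕ → Finset G} {e : ℕ → G}
    (hdis : ∀ i j g, g ∈ t i → g ∈ t j → i = j) (hsub : ∀ i, t i ⊆ rt F (e i)) {τ₁ τ₂ κ : ℝ}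
    (hτ₁ : 0 ≤ τ₁)
    (hcard : ∀ i, (t i).Nonempty → 1 / 2 * (F.card : ℝ) ≤ (t i).card)
    (hrest : ∀ i, (t i).Nonempty →
      (((rt F (e i)).filter fun g => ∀ j, g ∉ t j).card : ℝ) ≤ τ₁ * F.card)
    (hbd : ((bd F K).card : ℝ) ≤ τ₂ * F.card) (hκ : 4 * (τ₂ + K.card * τ₁) < κ) :
    ∀ᶠ W in fol G, ((bd (W.filter fun g => ∀ j, g ∉ t j) K).card : ℝ) ≤ κ * W.card := by
  have hFpos : (0 : ℝ) < F.card := by exact_mod_cast hF.card_pos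
  filter_upwards [eventually_inv K (sub_pos.2 hκ), eventually_card_mul_le (F * F⁻¹) one_pos]
    with W hW1 hW2
  rw [inv_iff] at hW1
  have hidx : ∀ g : G, ∃ i, (∃ j, g ∈ t j) → g ∈ t i := by
    intro g
    by_cases h : ∃ j, g ∈ t j
    · obtain ⟨j, hj⟩ := h; exact ⟨j, fun _ => hj⟩
    · exact ⟨0, fun h' => absurd h' h⟩
  choose idx hidx using hidx
  set Sel := (W.filter fun g => ∃ j, g ∈ t j).image idx with hSel
  have hSelne : ∀ i ∈ Sel, ∃ w ∈ W, w ∈ t i := by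
    intro i hi
    obtain ⟨w, hw, rfl⟩ := Finset.mem_image.1 hi
    obtain ⟨hw1, hw2⟩ := Finset.mem_filter.1 hw
    exact ⟨w, hw1, hidx w hw2⟩
  have hcover : bd (W.filter fun g => ∀ j, g ∉ t j) K ⊆ bd W K ∪ Sel.biUnion fun i =>
      bd (rt F (e i)) K ∪ K⁻¹ * (rt F (e i)).filter fun g => ∀ j, g ∉ t j := by
    intro g hg
    obtain ⟨⟨k, hk, h1⟩, k', hk', h2⟩ := mem_bd.1 hg
    obtain ⟨h1, h1'⟩ := Finset.mem_filter.1 h1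
    by_cases hW : k' * g ∈ W
    swap
    · exact Finset.mem_union_left _ (mem_bd.2 ⟨⟨k, hk, h1⟩, k', hk', hW⟩)
    have h3 : ∃ j, k' * g ∈ t j := by
      by_contra! hc
      exact h2 (Finset.mem_filter.2 ⟨hW, hc⟩)
    refine Finset.mem_union_right _ (Finset.mem_biUnion.2 ⟨idx (k' * g),
      Finset.mem_image.2 ⟨_, Finset.mem_filter.2 ⟨hW, h3⟩, rfl⟩, ?_⟩)
    by_cases hk3 : k * g ∈ rt F (e (idx (k' * g)))
    · refine Finset.mem_union_right _ (Finset.mem_mul.2 ⟨k⁻¹, by simpa, k * g,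
        Finset.mem_filter.2 ⟨hk3, h1'⟩, by simp⟩)
    · exact Finset.mem_union_left _ (mem_bd.2 ⟨⟨k', hk', hsub _ (hidx _ h3)⟩, k, hk, hk3⟩)
  have hpart : ∀ i ∈ Sel, ((bd (rt F (e i)) K ∪ K⁻¹ * (rt F (e i)).filter
      fun g => ∀ j, g ∉ t j).card : ℝ) ≤ (τ₂ + K.card * τ₁) * F.card := by
    intro i hi
    obtain ⟨w, -, hw⟩ := hSelne i hi
    have h1 := hrest i ⟨w, hw⟩
    have h2 : ((bd (rt F (e i)) K ∪ K⁻¹ * (rt F (e i)).filter fun g => ∀ j, g ∉ t j).card : ℝ) ≤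
        (bd F K).card + K.card * ((rt F (e i)).filter fun g => ∀ j, g ∉ t j).card := by
      norm_cast
      refine (Finset.card_union_le _ _).trans ?_
      rw [bd_rt, card_rt]
      refine Nat.add_le_add_left (Finset.card_mul_le.trans ?_) _
      rw [Finset.card_inv]
    have h3 := mul_le_mul_of_nonneg_left h1 (Nat.cast_nonneg (α := ℝ) K.card)
    linarith
  have hSelc : (Sel.card : ℝ) * F.card ≤ 4 * W.card := by
    have h1 : (∑ i ∈ Sel, ((t i).card : ℝ)) ≤ (F * F⁻¹ * W).card := by
      norm_cast
      rw [← Finset.card_biUnion]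
      · apply Finset.card_le_card
        intro x hx
        obtain ⟨i, hi, hx⟩ := Finset.mem_biUnion.1 hx
        obtain ⟨w, hw, hwt⟩ := hSelne i hi
        have h1 := mem_rt.1 (hsub i hx)
        have h2 := mem_rt.1 (hsub i hwt)
        refine Finset.mem_mul.2 ⟨(x * (e i)⁻¹) * (w * (e i)⁻¹)⁻¹, Finset.mul_mem_mul h1
          (Finset.inv_mem_inv h2), w, hw, by group⟩
      · intro i _ j _ hij
        exact Finset.disjoint_left.2 fun g hg hg' => hij (hdis i j g hg hg')
    have h2 : (∑ i ∈ Sel, (1 / 2 * (F.card : ℝ))) ≤ ∑ i ∈ Sel, ((t i).card : ℝ) :=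
      Finset.sum_le_sum fun i hi => by
        obtain ⟨w, -, hw⟩ := hSelne i hi
        exact hcard i ⟨w, hw⟩
    rw [Finset.sum_const, nsmul_eq_mul] at h2
    linarith
  have hc1 : ((bd (W.filter fun g => ∀ j, g ∉ t j) K).card : ℝ) ≤ (bd W K).card +
      ∑ i ∈ Sel, ((bd (rt F (e i)) K ∪ K⁻¹ * (rt F (e i)).filter
      fun g => ∀ j, g ∉ t j).card : ℝ) := by
    norm_cast
    refine (Finset.card_le_card hcover).trans ((Finset.card_union_le _ _).trans ?_)
    exact Nat.add_le_add_left Finset.card_biUnion_le _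
  have hc2 := Finset.sum_le_sum hpart
  rw [Finset.sum_const, nsmul_eq_mul] at hc2
  have hτ₂ : 0 ≤ τ₂ := nonneg_of_mul_nonneg_left ((Nat.cast_nonneg _).trans hbd) hFpos
  have h5 : 0 ≤ τ₂ + K.card * τ₁ := by positivity
  nlinarith

/-- `A` is a set of pointed shapes that is closed under moving the base point and whose elements
are `(K, δ)`-invariant. -/
def GoodShapes (A : Finset (Finset G)) (K : Finset G) (δ : ℝ) : Prop :=
  ∀ S ∈ A, InvariantSet S K δ ∧ ∀ h ∈ S, rt S h⁻¹ ∈ A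

/-- The pointed versions of the almost full invariant subsets of `F`. -/
noncomputable def trimmed (F K : Finset G) (δ θ : ℝ) : Finset (Finset G) :=
  (F.powerset.filter fun A => ((F \ A).card : ℝ) ≤ 2 * θ * F.card ∧ InvariantSet A K δ).biUnion
    fun A => A.image fun f => rt A f⁻¹

theorem mem_trimmed {F K S : Finset G} {δ θ : ℝ} : S ∈ trimmed F K δ θ ↔
    ∃ A ⊆ F, ((F \ A).card : ℝ) ≤ 2 * θ * F.card ∧ InvariantSet A K δ ∧ ∃ f ∈ A, rt A f⁻¹ = S := by
  simp only [trimmed, Finset.mem_biUnion, Finset.mem_filter, Finset.mem_powerset, Finset.mem_image,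
    and_assoc]

theorem goodShapes_trimmed (F K : Finset G) (δ θ : ℝ) : GoodShapes (trimmed F K δ θ) K δ := by
  intro S hS
  obtain ⟨A, h1, h2, h3, f, hf, rfl⟩ := mem_trimmed.1 hS
  refine ⟨inv_rt.2 h3, fun h hh => mem_trimmed.2 ⟨A, h1, h2, h3, h * f, by simpa using hh, ?_⟩⟩
  simp

theorem sum_trimmed_le {F K : Finset G} {δ θ η : ℝ} (hθ : θ ≤ 1 / 8) (hη : 0 < η)
    (hent : ((F.powerset.filter fun A => ((F \ A).card : ℝ) ≤ 2 * θ * F.card).card : ℝ)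
      ≤ Real.exp (η / 4 * F.card)) :
    ∑ S ∈ trimmed F K δ θ, Real.exp (-η * S.card) ≤ F.card * Real.exp (-(η / 4) * F.card) := by
  have h1 : ∀ S ∈ trimmed F K δ θ, Real.exp (-η * S.card) ≤ Real.exp (-(η / 2) * F.card) := by
    intro S hS
    obtain ⟨A, h1, h2, h3, f, hf, rfl⟩ := mem_trimmed.1 hS
    apply Real.exp_le_exp.2
    have h4 : (F.card : ℝ) ≤ (F \ A).card + A.card := by
      rw [← Nat.cast_add, Finset.card_sdiff_add_card_eq_card h1]
    rw [card_rt]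
    have h5 : (0 : ℝ) ≤ F.card := by positivity
    have h6 : 1 / 2 * (F.card : ℝ) ≤ A.card := by nlinarith
    nlinarith
  have h2 : ((trimmed F K δ θ).card : ℝ) ≤ Real.exp (η / 4 * F.card) * F.card := by
    refine le_trans (b := (((F.powerset.filter fun A =>
      ((F \ A).card : ℝ) ≤ 2 * θ * F.card).card * F.card : ℕ) : ℝ)) ?_ ?_
    · norm_cast
      refine (Finset.card_biUnion_le_card_mul _ _ F.card fun A hA => ?_).trans ?_
      · exact Finset.card_image_le.trans (Finset.card_le_card (Finset.mem_powerset.1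
          (Finset.mem_filter.1 hA).1))
      · refine Nat.mul_le_mul_right _ (Finset.card_le_card fun A hA => ?_)
        obtain ⟨h1, h2⟩ := Finset.mem_filter.1 hA
        exact Finset.mem_filter.2 ⟨h1, h2.1⟩
    · push_cast
      gcongr
  refine (Finset.sum_le_card_nsmul _ _ _ h1).trans ?_
  rw [nsmul_eq_mul]
  calc _ ≤ (Real.exp (η / 4 * F.card) * F.card) * Real.exp (-(η / 2) * F.card) := by gcongr
    _ = F.card * (Real.exp (η / 4 * F.card) * Real.exp (-(η / 2) * F.card)) := by ring
    _ = _ := by rw [← Real.exp_add]; congr 2; ring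

theorem card_bd_le_of_subset {A F K : Finset G} (h : A ⊆ F) :
    (bd A K).card ≤ (bd F K).card + K.card * (F \ A).card := by
  have : bd A K ⊆ bd F K ∪ K⁻¹ * (F \ A) := by
    intro g hg
    obtain ⟨⟨k, hk, h1⟩, k', hk', h2⟩ := mem_bd.1 hg
    by_cases h3 : k' * g ∈ F
    · exact Finset.mem_union_right _ (Finset.mem_mul.2 ⟨k'⁻¹, by simpa, k' * g,
        Finset.mem_sdiff.2 ⟨h3, h2⟩, by simp⟩)
    · exact Finset.mem_union_left _ (mem_bd.2 ⟨⟨k, hk, h h1⟩, k', hk', h3⟩)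
  refine (Finset.card_le_card this).trans ((Finset.card_union_le _ _).trans ?_)
  refine Nat.add_le_add_left (Finset.card_mul_le.trans ?_) _
  rw [Finset.card_inv]

namespace Partn

variable {P : Partn G}

theorem eventually_sat_filter (P : Partn G) {τ : ℝ} (hτ : 0 < τ) :
    ∀ᶠ F in fol G, ∀ x, (((rt F x).filter fun g => ¬ P.tile g ⊆ rt F x).card : ℝ)
      ≤ τ * F.card := by
  obtain ⟨D, hD⟩ := P.bounded
  filter_upwards [eventually_rt (eventually_card_leave_le D hτ)] with F hF x
  have := hF x
  rw [card_rt] at this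
  refine _root_.le_trans ?_ this
  norm_cast
  refine Finset.card_le_card fun g hg => ?_
  obtain ⟨h1, h2⟩ := Finset.mem_filter.1 hg
  obtain ⟨h, hh, h3⟩ := Finset.not_subset.1 h2
  exact Finset.mem_filter.2 ⟨h1, _, hD g h hh, by simpa using h3⟩

theorem sat_core (P : Partn G) (A : Finset G) (N : Set G) (hN : ∀ g ∈ N, ∀ h ∈ P.tile g, h ∈ N) :
    P.Sat (A.filter fun g => P.tile g ⊆ A ∧ g ∉ N) := by
  intro g hg h hh
  obtain ⟨h1, h2, h3⟩ := Finset.mem_filter.1 hg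
  refine Finset.mem_filter.2 ⟨h2 hh, ?_, fun hN' => h3 (hN h hN' g ?_)⟩
  · rwa [P.tile_eq hh]
  · rw [P.tile_eq hh]; exact P.mem_tile g

theorem IsRigid.eventually_drop [Infinite G] (hP : P.IsRigid) {θ τ : ℝ} (hτ : 0 < τ)
    (hθ8 : θ ≤ 1 / 8) (hτ8 : τ ≤ 1 / 8) :
    ∀ᶠ F in fol G, ∀ (x : G) (N : Set G), (∀ g ∈ N, ∀ h ∈ P.tile g, h ∈ N) →
      (((rt F x).filter (· ∈ N)).card : ℝ) ≤ θ * F.card →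
      ∃ t ⊆ rt F x, (∀ g ∈ t, g ∉ N) ∧ P.Sat t ∧ Rigid t ∧
        ((((rt F x).filter (· ∉ N)) \ t).card : ℝ) ≤ τ * F.card := by
  obtain ⟨n, hn0, hn⟩ := hP.drop (half_pos hτ)
  filter_upwards [P.eventually_sat_filter (half_pos hτ), eventually_le_card (2 * n)]
    with F hF hFn x N hN hc
  set Y := (rt F x).filter fun g => P.tile g ⊆ rt F x ∧ g ∉ N with hY
  have hFn' : (2 * n : ℝ) ≤ F.card := by exact_mod_cast hFn
  have hcover : rt F x ⊆ Y ∪ ((rt F x).filter fun g => ¬ P.tile g ⊆ rt F x) ∪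
      (rt F x).filter (· ∈ N) := by
    intro g hg
    simp only [hY, Finset.mem_union, Finset.mem_filter]
    tauto
  have h1 : (F.card : ℝ) ≤ Y.card + ((rt F x).filter fun g => ¬ P.tile g ⊆ rt F x).card +
      ((rt F x).filter (· ∈ N)).card := by
    rw [← card_rt F x]
    norm_cast
    refine (Finset.card_le_card hcover).trans ((Finset.card_union_le _ _).trans ?_)
    exact Nat.add_le_add_right (Finset.card_union_le _ _) _
  have h2 := hF x
  have h3 : (n : ℝ) ≤ Y.card := by nlinarith
  obtain ⟨t, ht1, ht2, ht3, ht4⟩ := hn Y (P.sat_core _ N hN) (by exact_mod_cast h3)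
  refine ⟨t, ht1.trans (Finset.filter_subset _ _), fun g hg =>
    (Finset.mem_filter.1 (ht1 hg)).2.2, ht2, ht4, ?_⟩
  have h4 : ((rt F x).filter (· ∉ N)) \ t ⊆
      (Y \ t) ∪ ((rt F x).filter fun g => ¬ P.tile g ⊆ rt F x) := by
    intro g hg
    simp only [hY, Finset.mem_union, Finset.mem_filter, Finset.mem_sdiff] at hg ⊢
    tauto
  have h5 : ((((rt F x).filter (· ∉ N)) \ t).card : ℝ) ≤ (Y \ t).card +
      ((rt F x).filter fun g => ¬ P.tile g ⊆ rt F x).card := by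
    norm_cast
    exact (Finset.card_le_card h4).trans (Finset.card_union_le _ _)
  have h6 : (Y.card : ℝ) ≤ F.card := by
    rw [← card_rt F x]
    exact_mod_cast Finset.card_le_card (Finset.filter_subset _ _)
  nlinarith

end Partn

theorem eventually_mul_exp_le {b σ : ℝ} (hb : 0 < b) (hσ : 0 < σ) :
    ∀ᶠ n : ℕ in atTop, (n : ℝ) * Real.exp (-b * n) ≤ σ := by
  have h1 := Real.tendsto_pow_mul_exp_neg_atTop_nhds_zero 1
  have h2 : Tendsto (fun n : ℕ => b * (n : ℝ)) atTop atTop :=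
    tendsto_natCast_atTop_atTop.const_mul_atTop hb
  filter_upwards [(h1.comp h2).eventually_le_const (mul_pos hb hσ)] with n hn
  simp only [Function.comp, pow_one] at hn
  rw [mul_assoc] at hn
  have := le_of_mul_le_mul_left hn hb
  rwa [neg_mul]

theorem eventually_fol_of_card [Infinite G] {p : ℕ → Prop} (h : ∀ᶠ n in atTop, p n) :
    ∀ᶠ F in fol G, p F.card := by
  obtain ⟨n, hn⟩ := eventually_atTop.1 h
  filter_upwards [eventually_le_card n] with F hF using hn _ hF

namespace Partn

variable {P : Partn G}

theorem IsRigid.exists_grow [Countable G] [Infinite G] (hG : IsAmenable G) (hP : P.IsRigid)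
    (K : Finset G) {δ η θ : ℝ} (hδ : 0 < δ) (hη : 0 < η) (hθ : 0 < θ) (hθ8 : θ ≤ 1 / 8)
    (hθK : K.card * θ ≤ δ / 16)
    (hent : ∀ F : Finset G, ((F.powerset.filter fun A =>
      ((F \ A).card : ℝ) ≤ 2 * θ * F.card).card : ℝ) ≤ Real.exp (η / 4 * F.card))
    {B : Set G} {a : ℝ} (ha : 0 ≤ a)
    (hB : ∀ᶠ W in fol G, ((W.filter (· ∈ B)).card : ℝ) ≤ a * W.card) {σ τ : ℝ} (hσ : 0 < σ)
    (hτ : 0 < τ) :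
    ∃ Q : Partn G, P ≤ Q ∧ Q.IsRigid ∧ ∃ A : Finset (Finset G), GoodShapes A K δ ∧
      ∑ S ∈ A, Real.exp (-η * S.card) ≤ σ ∧ (∀ g, Q.shape g ∈ A ∨ Q.tile g = P.tile g) ∧
      ∀ᶠ W in fol G, ((W.filter fun g => g ∈ B ∧ Q.shape g ∉ A).card : ℝ)
        ≤ ((1 - θ / 2) * a + τ) * W.card := by
  have := fol_neBot hG
  obtain ⟨K', δ', hδ', hB⟩ := eventually_fol.1 hB
  set κ := δ' * τ / 2 with hκ
  have hκ0 : 0 < κ := by positivity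
  set τ₂ := κ / 16 with hτ₂
  set τ₁ := min θ (κ / (16 * (K'.card + 1))) with hτ₁
  have hτ₁0 : 0 < τ₁ := by positivity
  have hτ₁θ : τ₁ ≤ θ := min_le_left _ _
  have hκ' : 4 * (τ₂ + K'.card * τ₁) < κ := by
    have h1 : τ₁ ≤ κ / (16 * (K'.card + 1)) := min_le_right _ _
    rw [le_div_iff₀ (by positivity)] at h1
    nlinarith
  obtain ⟨F, hF, hFK, hFK', hFdrop, hFσ⟩ := (eventually_nonempty.and
    ((eventually_inv K (by positivity : 0 < δ / 8)).and ((eventually_inv K'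
    (by positivity : 0 < τ₂)).and ((hP.eventually_drop hτ₁0 hθ8 (hτ₁θ.trans hθ8)).and
    (eventually_fol_of_card (G := G)
      (eventually_mul_exp_le (by positivity : 0 < η / 4) hσ)))))).exists
  have hFpos : (0 : ℝ) < F.card := by exact_mod_cast hF.card_pos
  obtain ⟨t, e, hdis, hsat, hsub, hne, hdens⟩ := P.exists_greedy hF hθ8 hτ₁θ hFdrop
  obtain ⟨Q, hQ1, hQ2⟩ := P.exists_glue t hdis hsat (F * F⁻¹) (by
    intro i g hg h hh
    have h1 := mem_rt.1 (hsub i hg)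
    have h2 := mem_rt.1 (hsub i hh)
    exact Finset.mem_mul.2 ⟨_, h2, _, Finset.inv_mem_inv h1, by group⟩)
  have hmemA : ∀ i, ∀ g ∈ t i, Q.shape g ∈ trimmed F K δ θ := by
    intro i g hg
    obtain ⟨-, hc, -⟩ := hne i ⟨g, hg⟩
    have hA : rt (t i) (e i)⁻¹ ⊆ F := rt_subset_iff.2 (by simpa using hsub i)
    have hA2 : ((F \ rt (t i) (e i)⁻¹).card : ℝ) ≤ 2 * θ * F.card := by
      have h1 : (F.card : ℝ) = (F \ rt (t i) (e i)⁻¹).card + (rt (t i) (e i)⁻¹).card := by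
        rw [← Nat.cast_add, Finset.card_sdiff_add_card_eq_card hA]
      rw [card_rt] at h1
      linarith
    refine mem_trimmed.2 ⟨_, hA, hA2, ?_, g * (e i)⁻¹, by simpa using hg, ?_⟩
    · rw [inv_iff] at hFK ⊢
      have h1 : ((bd (rt (t i) (e i)⁻¹) K).card : ℝ) ≤ (bd F K).card +
        K.card * (F \ rt (t i) (e i)⁻¹).card := by exact_mod_cast card_bd_le_of_subset hA
      rw [card_rt]
      have h2 := mul_le_mul_of_nonneg_left hA2 (Nat.cast_nonneg (α := ℝ) K.card)
      have h3 : 3 / 4 * (F.card : ℝ) ≤ (t i).card := by nlinarith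
      nlinarith [mul_le_mul_of_nonneg_right hθK hFpos.le]
    · rw [shape, hQ1 i g hg]; simp
  refine ⟨Q, fun g => ?_, fun g => ?_, trimmed F K δ θ, goodShapes_trimmed _ _ _ _,
    (sum_trimmed_le hθ8 hη (hent F)).trans hFσ, fun g => ?_, ?_⟩
  · by_cases h : ∃ i, g ∈ t i
    · obtain ⟨i, hi⟩ := h
      rw [hQ1 i g hi]; exact hsat i g hi
    · push Not at h
      rw [hQ2 g h]
  · by_cases h : ∃ i, g ∈ t i
    · obtain ⟨i, hi⟩ := h
      rw [hQ1 i g hi]; exact (hne i ⟨g, hi⟩).1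
    · push Not at h
      rw [hQ2 g h]; exact hP g
  · by_cases h : ∃ i, g ∈ t i
    · obtain ⟨i, hi⟩ := h
      exact Or.inl (hmemA i g hi)
    · push Not at h
      exact Or.inr (hQ2 g h)
  · have hd := eventually_density (N := {g | ∃ j, g ∈ t j}) hF (half_pos hθ) hdens
    have hbd := eventually_card_bd_le hF hdis hsub hτ₁0.le
      (fun i hi => by
        have := (hne i hi).2.1
        nlinarith) (fun i hi => (hne i hi).2.2) (inv_iff.1 hFK').le hκ'
    filter_upwards [hd, hbd, eventually_nonempty] with W hW1 hW2 hW
    have hWpos : (0 : ℝ) < W.card := by exact_mod_cast hW.card_pos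
    set V := W.filter fun g => ∀ j, g ∉ t j with hV
    have hVc : (V.card : ℝ) ≤ (1 - θ / 2) * W.card := by
      have h3 := Finset.card_filter_add_card_filter_not (s := W) (fun g => ∃ j, g ∈ t j)
      push Not at h3
      have h4 : (W.card : ℝ) = (W.filter fun g => ∃ j, g ∈ t j).card + V.card := by
        exact_mod_cast h3.symm
      have h5 : (θ - θ / 2) * W.card ≤ ((W.filter fun g => ∃ j, g ∈ t j).card : ℝ) := hW1
      linarith
    have hsubV : (W.filter fun g => g ∈ B ∧ Q.shape g ∉ trimmed F K δ θ) ⊆ V.filter (· ∈ B) := by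
      intro g hg
      obtain ⟨h1, h2, h3⟩ := Finset.mem_filter.1 hg
      exact Finset.mem_filter.2 ⟨Finset.mem_filter.2 ⟨h1, fun j hj => h3 (hmemA j g hj)⟩, h2⟩
    have hle : ((W.filter fun g => g ∈ B ∧ Q.shape g ∉ trimmed F K δ θ).card : ℝ) ≤
        (V.filter (· ∈ B)).card := by exact_mod_cast Finset.card_le_card hsubV
    refine hle.trans ?_
    by_cases hVi : InvariantSet V K' δ'
    · have h1 := hB V hVi
      have h2 := mul_le_mul_of_nonneg_left hVc ha
      nlinarith
    · rw [inv_iff, not_lt] at hVi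
      have h1 : δ' * V.card ≤ δ' * (τ * W.card) := by nlinarith
      have h2 := le_of_mul_le_mul_left h1 hδ'
      have h3 : ((V.filter (· ∈ B)).card : ℝ) ≤ V.card := by
        exact_mod_cast Finset.card_filter_le _ _
      have h4 : 0 ≤ (1 - θ / 2) * a := mul_nonneg (by linarith) ha
      nlinarith

theorem IsRigid.exists_iterate [Countable G] [Infinite G] (hG : IsAmenable G) (hP : P.IsRigid)
    (K : Finset G) {δ η : ℝ} (hδ : 0 < δ) (hη : 0 < η) {a σ : ℝ} (ha : 0 < a) (hσ : 0 < σ) :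
    ∃ Q : Partn G, P ≤ Q ∧ Q.IsRigid ∧ ∃ A : Finset (Finset G), GoodShapes A K δ ∧
      ∑ S ∈ A, Real.exp (-η * S.card) ≤ σ ∧ (∀ g, Q.shape g ∈ A ∨ Q.tile g = P.tile g) ∧
      ∀ᶠ W in fol G, ((W.filter fun g => Q.shape g ∉ A).card : ℝ) ≤ a * W.card := by
  obtain ⟨θ₀, hθ₀, hent⟩ := exists_card_almost_full_le (α := G) (by positivity : 0 < η / 4)
  set θ := min θ₀ (min (1 / 8) (δ / 16 / (K.card + 1))) with hθ
  have hθ0 : 0 < θ := by positivity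
  have hθ8 : θ ≤ 1 / 8 := (min_le_right _ _).trans (min_le_left _ _)
  have hθK : K.card * θ ≤ δ / 16 := by
    have h1 : θ ≤ δ / 16 / (K.card + 1) := (min_le_right _ _).trans (min_le_right _ _)
    rw [le_div_iff₀ (by positivity)] at h1
    nlinarith
  have hent' := hent θ (min_le_left _ _)
  have key : ∀ n : ℕ, ∀ σ > 0, ∃ Q : Partn G, P ≤ Q ∧ Q.IsRigid ∧ ∃ A : Finset (Finset G),
      GoodShapes A K δ ∧ ∑ S ∈ A, Real.exp (-η * S.card) ≤ σ ∧
      (∀ g, Q.shape g ∈ A ∨ Q.tile g = P.tile g) ∧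
      ∀ᶠ W in fol G, ((W.filter fun g => Q.shape g ∉ A).card : ℝ)
        ≤ max a ((1 - θ / 4) ^ n) * W.card := by
    intro n
    induction n with
    | zero =>
      intro σ hσ
      refine ⟨P, le_refl P, hP, ∅, by simp [GoodShapes], by simpa using hσ.le, fun g => Or.inr rfl,
        Eventually.of_forall fun W => ?_⟩
      have h1 : ((W.filter fun g => P.shape g ∉ (∅ : Finset (Finset G))).card : ℝ) ≤ W.card := by
        exact_mod_cast Finset.card_filter_le _ _
      have h2 : (1 : ℝ) ≤ max a ((1 - θ / 4) ^ 0) := by simp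
      nlinarith [(Nat.cast_nonneg W.card : (0 : ℝ) ≤ W.card)]
    | succ n ih =>
      intro σ hσ
      obtain ⟨Q, hPQ, hQ, A, hA, hAσ, hAQ, hW⟩ := ih (σ / 2) (half_pos hσ)
      set b := max a ((1 - θ / 4) ^ n) with hb
      have hab : a ≤ b := le_max_left _ _
      obtain ⟨R, hQR, hR, A', hA', hAσ', hAR, hW'⟩ := hQ.exists_grow hG K hδ hη hθ0 hθ8 hθK hent'
        (ha.le.trans hab) (B := {g | Q.shape g ∉ A})
        (by simpa only [Set.mem_ofPred_eq] using hW) (half_pos hσ)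
        (by positivity : 0 < θ / 4 * a)
      refine ⟨R, le_trans hPQ hQR, hR, A ∪ A', ?_, ?_, fun g => ?_, ?_⟩
      · intro S hS
        rcases Finset.mem_union.1 hS with h | h
        · exact ⟨(hA S h).1, fun x hx => Finset.mem_union_left _ ((hA S h).2 x hx)⟩
        · exact ⟨(hA' S h).1, fun x hx => Finset.mem_union_right _ ((hA' S h).2 x hx)⟩
      · have h1 := Finset.sum_union_inter (s₁ := A) (s₂ := A')
          (f := fun S : Finset G => Real.exp (-η * S.card))
        have h2 : 0 ≤ ∑ S ∈ A ∩ A', Real.exp (-η * S.card) :=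
          Finset.sum_nonneg fun _ _ => (Real.exp_pos _).le
        linarith
      · rcases hAR g with h | h
        · exact Or.inl (Finset.mem_union_right _ h)
        · rcases hAQ g with h' | h'
          · left
            rw [shape, h]
            exact Finset.mem_union_left _ h'
          · exact Or.inr (h.trans h')
      · simp only [Set.mem_ofPred_eq] at hW'
        filter_upwards [hW'] with W hW'
        have h1 : (W.filter fun g => R.shape g ∉ A ∪ A') ⊆
            W.filter fun g => Q.shape g ∉ A ∧ R.shape g ∉ A' := by
          intro g hg
          obtain ⟨h1, h2⟩ := Finset.mem_filter.1 hg
          rw [Finset.mem_union, not_or] at h2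
          refine Finset.mem_filter.2 ⟨h1, fun h3 => h2.1 ?_, h2.2⟩
          rwa [shape, (hAR g).resolve_left h2.2]
        have h2 : ((W.filter fun g => R.shape g ∉ A ∪ A').card : ℝ) ≤
          ((1 - θ / 2) * b + θ / 4 * a) * W.card :=
          (Nat.cast_le.2 (Finset.card_le_card h1)).trans hW'
        refine h2.trans ?_
        gcongr
        have h3 : (1 - θ / 2) * b + θ / 4 * a ≤ (1 - θ / 4) * b := by nlinarith
        refine h3.trans ?_
        rw [hb, mul_max_of_nonneg _ _ (by linarith), pow_succ']
        refine max_le_max ?_ le_rfl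
        nlinarith
  have hlim := tendsto_pow_atTop_nhds_zero_of_lt_one (r := 1 - θ / 4) (by linarith) (by linarith)
  obtain ⟨n, hn⟩ := (hlim.eventually_le_const ha).exists
  have := key n σ hσ
  rwa [max_eq_left hn] at this

end Partn

theorem card_bd_le_of_superset {A T K : Finset G} (h : A ⊆ T) :
    (bd T K).card ≤ (bd A K).card + K.card * (T \ A).card := by
  have : bd T K ⊆ bd A K ∪ K⁻¹ * (T \ A) := by
    intro g hg
    obtain ⟨⟨k, hk, h1⟩, k', hk', h2⟩ := mem_bd.1 hg
    by_cases h3 : k * g ∈ A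
    · exact Finset.mem_union_left _ (mem_bd.2 ⟨⟨k, hk, h3⟩, k', hk', fun h4 => h2 (h h4)⟩)
    · exact Finset.mem_union_right _ (Finset.mem_mul.2 ⟨k⁻¹, by simpa, k * g,
        Finset.mem_sdiff.2 ⟨h1, h3⟩, by simp⟩)
  refine (Finset.card_le_card this).trans ((Finset.card_union_le _ _).trans ?_)
  refine Nat.add_le_add_left (Finset.card_mul_le.trans ?_) _
  rw [Finset.card_inv]

namespace Partn

variable {P Q : Partn G}

theorem exists_pullback (P : Partn G) (ψ : G → G) (D : Finset G) (hD : ∀ g, ψ g * g⁻¹ ∈ D) :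
    ∃ Q : Partn G, ∀ g h, h ∈ Q.tile g ↔ P.tile (ψ h) = P.tile (ψ g) := by
  obtain ⟨E, hE⟩ := P.bounded
  have hb : ∀ g h, P.tile (ψ h) = P.tile (ψ g) → h * g⁻¹ ∈ D⁻¹ * E * D := by
    intro g h e
    refine Finset.mem_mul.2 ⟨(ψ h * h⁻¹)⁻¹ * (ψ h * (ψ g)⁻¹), Finset.mul_mem_mul
      (Finset.inv_mem_inv (hD h)) (hE _ _ (mem_tile_iff.2 e)), ψ g * g⁻¹, hD g, by group⟩
  let f : G → Finset G := fun g => (rt (D⁻¹ * E * D) g).filter fun h => P.tile (ψ h) = P.tile (ψ g)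
  have hf : ∀ g h, h ∈ f g ↔ P.tile (ψ h) = P.tile (ψ g) := by
    intro g h
    simp only [f, Finset.mem_filter, and_iff_right_iff_imp, mem_rt]
    exact hb g h
  refine ⟨⟨f, fun g => (hf g g).2 rfl, fun {g h} hh => ?_, _, fun g h hh => hb g h ((hf g h).1 hh)⟩,
    hf⟩
  ext x
  rw [hf, hf, (hf g h).1 hh]

theorem Sat.sum_nonneg {A : Finset G} (hA : P.Sat A) {f : G → ℝ}
    (h : ∀ g ∈ A, 0 ≤ ∑ x ∈ P.tile g, f x) : 0 ≤ ∑ x ∈ A, f x := by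
  rw [← hA.biUnion_image, Finset.sum_biUnion (pairwiseDisjoint_image A)]
  refine Finset.sum_nonneg fun t ht => ?_
  obtain ⟨g, hg, rfl⟩ := Finset.mem_image.1 ht
  exact h g hg

theorem Sat.mul_card_le {A : Finset G} (hA : P.Sat A) {p : G → Prop} {c : ℝ}
    (h : ∀ g ∈ A, c * (P.tile g).card ≤ ((P.tile g).filter p).card) :
    c * A.card ≤ (A.filter p).card := by
  have := hA.sum_nonneg (f := fun x => (if p x then 1 else 0) - c) fun g hg => by
    rw [Finset.sum_sub_distrib, Finset.sum_boole, Finset.sum_const, nsmul_eq_mul]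
    linarith [h g hg]
  rw [Finset.sum_sub_distrib, Finset.sum_boole, Finset.sum_const, nsmul_eq_mul] at this
  linarith

theorem Sat.card_bd_le {A K : Finset G} (hA : P.Sat A) {δ : ℝ}
    (h : ∀ g ∈ A, ((bd (P.tile g) K).card : ℝ) ≤ δ * (P.tile g).card) :
    ((bd A K).card : ℝ) ≤ δ * A.card := by
  have h1 : bd A K ⊆ (A.image P.tile).biUnion fun t => bd t K := by
    intro g hg
    obtain ⟨⟨k, hk, h1⟩, k', hk', h2⟩ := mem_bd.1 hg
    exact Finset.mem_biUnion.2 ⟨_, Finset.mem_image_of_mem _ h1,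
      mem_bd.2 ⟨⟨k, hk, P.mem_tile _⟩, k', hk', fun h3 => h2 (hA _ h1 h3)⟩⟩
  have h2 : ((bd A K).card : ℝ) ≤ ∑ t ∈ A.image P.tile, ((bd t K).card : ℝ) := by
    exact_mod_cast (Finset.card_le_card h1).trans Finset.card_biUnion_le
  refine h2.trans ?_
  have h3 : A.card = ∑ t ∈ A.image P.tile, t.card := by
    conv_lhs => rw [← hA.biUnion_image]
    exact Finset.card_biUnion (pairwiseDisjoint_image A)
  rw [h3]
  push_cast
  rw [Finset.mul_sum]
  refine Finset.sum_le_sum fun t ht => ?_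
  obtain ⟨g, hg, rfl⟩ := Finset.mem_image.1 ht
  exact h g hg

/-- The partition into singletons. -/
def bot (G : Type*) [Group G] : Partn G where
  tile g := {g}
  mem_tile g := by simp
  tile_eq h := by simpa using h
  bounded := ⟨{1}, by simp +contextual⟩

theorem isRigid_bot : (bot G).IsRigid := by
  intro g
  refine ⟨⟨g, by simp [bot]⟩, fun h e => ?_⟩
  have : g ∈ rt ((bot G).tile g) h := by rw [e]; simp [bot]
  simpa [bot] using this

theorem shape_mem_of_mem_tile {A : Finset (Finset G)} {K : Finset G} {δ : ℝ}
    (hA : GoodShapes A K δ) {g h : G} (hg : P.shape g ∈ A) (hh : h ∈ P.tile g) :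
    P.shape h ∈ A := by
  have := (hA _ hg).2 (h * g⁻¹) (mem_shape.2 (by simpa))
  rwa [shape_of_mem hh, show g * h⁻¹ = (h * g⁻¹)⁻¹ by group]

theorem exists_matching {W : Finset G} (hW : W.Nonempty) {U C : Set G}
    (h : ∀ g, ((rt W g).filter (· ∈ U)).card ≤ ((rt W g).filter (· ∈ C)).card) :
    ∃ φ : U → G, Function.Injective φ ∧ ∀ u : U, φ u ∈ C ∧ φ u * (u : G)⁻¹ ∈ W * W⁻¹ := by
  obtain ⟨φ, hφ, hφ'⟩ := (Finset.all_card_le_biUnion_card_iff_exists_injective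
    (fun u : U => (rt (W * W⁻¹) (u : G)).filter (· ∈ C))).1 (by
      intro s
      set X := s.map (Function.Embedding.subtype _) with hX
      set Y := s.biUnion fun u : U => (rt (W * W⁻¹) (u : G)).filter (· ∈ C) with hY
      have hXU : ∀ x ∈ X, x ∈ U := by
        intro x hx
        obtain ⟨u, -, rfl⟩ := Finset.mem_map.1 hx
        exact u.2
      have h1 : W.card * X.card ≤ ∑ g ∈ W⁻¹ * X, ((rt W g).filter (· ∈ U)).card := by
        have e : ∀ x ∈ X, W.card ≤ ((W⁻¹ * X).filter fun g => x ∈ rt W g).card := by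
          intro x hx
          refine Finset.card_le_card_of_injOn (fun w => w⁻¹ * x) ?_ ?_
          · intro w hw
            refine Finset.mem_coe.2 (Finset.mem_filter.2 ⟨Finset.mul_mem_mul
              (Finset.inv_mem_inv hw) hx, ?_⟩)
            simpa using hw
          · intro w _ w' _ e
            simpa using e
        calc W.card * X.card = ∑ x ∈ X, W.card := by rw [Finset.sum_const, smul_eq_mul, mul_comm]
          _ ≤ ∑ x ∈ X, ((W⁻¹ * X).filter fun g => x ∈ rt W g).card := Finset.sum_le_sum e
          _ = ∑ g ∈ W⁻¹ * X, (X.filter fun x => x ∈ rt W g).card := by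
            simp_rw [Finset.card_filter]
            exact Finset.sum_comm
          _ ≤ _ := by
            refine Finset.sum_le_sum fun g _ => Finset.card_le_card fun x hx => ?_
            obtain ⟨hx1, hx2⟩ := Finset.mem_filter.1 hx
            exact Finset.mem_filter.2 ⟨hx2, hXU x hx1⟩
      have h2 : ∑ g ∈ W⁻¹ * X, ((rt W g).filter (· ∈ C)).card ≤ W.card * Y.card := by
        calc ∑ g ∈ W⁻¹ * X, ((rt W g).filter (· ∈ C)).card
            ≤ ∑ g ∈ W⁻¹ * X, (Y.filter fun y => y ∈ rt W g).card := by
              refine Finset.sum_le_sum fun g hg => Finset.card_le_card fun y hy => ?_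
              obtain ⟨hy1, hy2⟩ := Finset.mem_filter.1 hy
              refine Finset.mem_filter.2 ⟨?_, hy1⟩
              obtain ⟨w, hw, x, hx, rfl⟩ := Finset.mem_mul.1 hg
              obtain ⟨u, hu, rfl⟩ := Finset.mem_map.1 hx
              refine Finset.mem_biUnion.2 ⟨u, hu, Finset.mem_filter.2 ⟨?_, hy2⟩⟩
              rw [mem_rt] at hy1 ⊢
              refine Finset.mem_mul.2 ⟨_, hy1, w, hw, ?_⟩
              simp [mul_assoc]
          _ = ∑ y ∈ Y, ((W⁻¹ * X).filter fun g => y ∈ rt W g).card := by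
            simp_rw [Finset.card_filter]
            exact Finset.sum_comm
          _ ≤ ∑ y ∈ Y, W.card := by
            refine Finset.sum_le_sum fun y _ => ?_
            refine Finset.card_le_card_of_injOn (fun g => y * g⁻¹) ?_ ?_
            · intro g hg
              exact mem_rt.1 (Finset.mem_filter.1 hg).2
            · intro g _ g' _ e
              simpa using e
          _ = W.card * Y.card := by rw [Finset.sum_const, smul_eq_mul, mul_comm]
      have h3 := h1.trans ((Finset.sum_le_sum fun g _ => h g).trans h2)
      have h4 := Nat.le_of_mul_le_mul_left h3 hW.card_pos
      simpa [hX] using h4)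
  refine ⟨φ, hφ, fun u => ?_⟩
  obtain ⟨h1, h2⟩ := Finset.mem_filter.1 (hφ' u)
  exact ⟨h2, mem_rt.1 h1⟩

theorem exists_exact [Countable G] [Infinite G] (hG : IsAmenable G) (K : Finset G) {δ : ℝ}
    (hδ : 0 < δ) : ∃ P : Partn G, ∀ g, InvariantSet (P.tile g) K δ := by
  have := fol_neBot hG
  obtain ⟨b, hb⟩ : ∃ b : ℝ, b = min (1 / 2) (δ / (2 * (K.card + 1))) := ⟨_, rfl⟩
  have hb0 : 0 < b := by rw [hb]; positivity
  have hb1 : b ≤ 1 / 2 := hb ▸ min_le_left _ _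
  have hbK : K.card * b ≤ δ / 2 := by
    have h1 : b ≤ δ / (2 * (K.card + 1)) := hb ▸ min_le_right _ _
    rw [le_div_iff₀ (by positivity)] at h1
    nlinarith
  obtain ⟨n, hn⟩ := exists_nat_ge (1 / b)
  have hbn : 1 ≤ b * n := by
    rw [div_le_iff₀ hb0] at hn; linarith
  obtain ⟨Q, -, -, A, hA, hsum, -, hbad⟩ := isRigid_bot.exists_iterate hG K (half_pos hδ) one_pos
    (a := b / 16) (by positivity) (Real.exp_pos (-n))
  have hcard : ∀ S ∈ A, 1 ≤ b * S.card := by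
    intro S hS
    have h1 := (Finset.single_le_sum (f := fun S : Finset G => Real.exp (-1 * S.card))
      (fun _ _ => (Real.exp_pos _).le) hS).trans hsum
    have h2 := Real.exp_le_exp.1 h1
    nlinarith
  have hsub : ∀ t : Finset G, ∃ s ⊆ t, s.card = ⌊b * t.card⌋₊ := by
    intro t
    refine Finset.exists_subset_card_eq (Nat.floor_le_of_le ?_)
    have : (0 : ℝ) ≤ t.card := by positivity
    nlinarith
  choose sub hsub hsubc using hsub
  have hsub1 : ∀ t, ((sub t).card : ℝ) ≤ b * t.card := by
    intro t
    rw [hsubc]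
    exact Nat.floor_le (by positivity)
  have hsub2 : ∀ g, Q.shape g ∈ A → b / 2 * (Q.tile g).card ≤ (sub (Q.tile g)).card := by
    intro g hg
    have h1 : 1 ≤ b * (Q.tile g).card := by
      rw [← rt_shape, card_rt]; exact hcard _ hg
    have h2 := Nat.lt_floor_add_one (b * ((Q.tile g).card : ℝ))
    have h3 : 1 ≤ ⌊b * ((Q.tile g).card : ℝ)⌋₊ := Nat.le_floor (by simpa using h1)
    have h4 : (1 : ℝ) ≤ ⌊b * ((Q.tile g).card : ℝ)⌋₊ := by exact_mod_cast h3
    rw [hsubc]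
    linarith
  obtain ⟨U, mem_U⟩ : ∃ U : Set G, ∀ g, g ∈ U ↔ Q.shape g ∉ A :=
    ⟨{g | Q.shape g ∉ A}, fun _ => .rfl⟩
  obtain ⟨C, mem_C⟩ : ∃ C : Set G, ∀ g, g ∈ C ↔ Q.shape g ∈ A ∧ g ∈ sub (Q.tile g) :=
    ⟨{g | Q.shape g ∈ A ∧ g ∈ sub (Q.tile g)}, fun _ => .rfl⟩
  have hU : ∀ g ∈ U, ∀ h ∈ Q.tile g, h ∈ U := by
    intro g hg h hh
    rw [mem_U] at hg ⊢
    exact fun h1 => hg (shape_mem_of_mem_tile hA h1 (mem_tile_iff.2 (Q.tile_eq hh).symm))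
  have hUA : ∀ g, g ∉ U → Q.shape g ∈ A := fun g hg => by rwa [mem_U, not_not] at hg
  obtain ⟨W, hW1, hW2, hW⟩ := ((eventually_rt hbad).and ((eventually_sat_filter Q
    (τ := 1 / 8) (by norm_num)).and eventually_nonempty)).exists
  have hmatch : ∀ g, ((rt W g).filter (· ∈ U)).card ≤ ((rt W g).filter (· ∈ C)).card := by
    intro g
    have h1 := hW1 g
    simp only [← mem_U] at h1
    have h2 := hW2 g
    rw [card_rt] at h1
    set V := rt W g with hV
    have hVc : (V.card : ℝ) = W.card := by rw [hV, card_rt]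
    have h3 := sat_core Q V U hU
    set V' := V.filter fun g => Q.tile g ⊆ V ∧ g ∉ U with hV'
    have h4 : (b / 2) * V'.card ≤ (V'.filter (· ∈ C)).card := by
      refine h3.mul_card_le fun x hx => (hsub2 x ?_).trans ?_
      · exact hUA _ (Finset.mem_filter.1 hx).2.2
      · have hxA : Q.shape x ∈ A := hUA _ (Finset.mem_filter.1 hx).2.2
        refine Nat.cast_le.2 (Finset.card_le_card fun y hy => Finset.mem_filter.2 ⟨hsub _ hy, ?_⟩)
        rw [mem_C, Q.tile_eq (hsub _ hy)]
        exact ⟨shape_mem_of_mem_tile hA hxA (hsub _ hy), hy⟩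
    have h5 : ((V'.filter (· ∈ C)).card : ℝ) ≤ (V.filter (· ∈ C)).card :=
      Nat.cast_le.2 (Finset.card_le_card (Finset.filter_subset_filter _ (Finset.filter_subset _ _)))
    have h6 : (V.card : ℝ) ≤ V'.card + ((V.filter fun g => ¬ Q.tile g ⊆ V).card +
        (V.filter (· ∈ U)).card) := by
      have : V ⊆ V' ∪ ((V.filter fun g => ¬ Q.tile g ⊆ V) ∪ V.filter (· ∈ U)) := by
        intro x hx
        simp only [Finset.mem_union, Finset.mem_filter, hx, true_and, hV']
        by_cases h : Q.tile x ⊆ V <;> by_cases h' : x ∈ U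
        · exact Or.inr (Or.inr h')
        · exact Or.inl ⟨h, h'⟩
        · exact Or.inr (Or.inr h')
        · exact Or.inr (Or.inl h)
      exact_mod_cast (Finset.card_le_card this).trans ((Finset.card_union_le _ _).trans
        (Nat.add_le_add_left (Finset.card_union_le _ _) _))
    have h7 : ((V.filter (· ∈ U)).card : ℝ) ≤ b / 16 * W.card := by convert h1
    have h8 : (3 / 4 : ℝ) * W.card ≤ V'.card := by
      have : b / 16 * W.card ≤ 1 / 8 * W.card :=
        mul_le_mul_of_nonneg_right (by linarith) (by positivity)
      linarith
    have h9 : (b / 2) * (3 / 4 * W.card) ≤ (b / 2) * V'.card := by gcongr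
    have h10 : (0 : ℝ) ≤ b * W.card := by positivity
    exact_mod_cast (by linarith : ((V.filter (· ∈ U)).card : ℝ) ≤ (V.filter (· ∈ C)).card)
  obtain ⟨φ, hφ, hφC⟩ := exists_matching hW hmatch
  let ψ : G → G := fun g => if h : g ∈ U then φ ⟨g, h⟩ else g
  have hψU : ∀ g (h : g ∈ U), ψ g = φ ⟨g, h⟩ := fun g h => dif_pos h
  have hψ : ∀ g, g ∉ U → ψ g = g := fun g h => dif_neg h
  clear_value ψ
  obtain ⟨P, hP⟩ := exists_pullback Q ψ (insert 1 (W * W⁻¹)) (by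
    intro g
    by_cases h : g ∈ U
    · rw [hψU g h]; exact Finset.mem_insert_of_mem (hφC ⟨g, h⟩).2
    · simp [hψ g h])
  refine ⟨P, fun g => inv_iff.2 ?_⟩
  have hg : Q.shape (ψ g) ∈ A := by
    by_cases h : g ∈ U
    · rw [hψU g h]; exact ((mem_C _).1 (hφC ⟨g, h⟩).1).1
    · rw [hψ g h]; exact hUA g h
  have h1 : Q.tile (ψ g) ⊆ P.tile g := by
    intro h hh
    have h2 : Q.shape h ∈ A := shape_mem_of_mem_tile hA hg hh
    rw [hP, hψ h (fun h' => (mem_U h).1 h' h2), Q.tile_eq hh]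
  have h2 : (P.tile g \ Q.tile (ψ g)).card ≤ (sub (Q.tile (ψ g))).card := by
    have key : ∀ h ∈ P.tile g \ Q.tile (ψ g), ∃ hU : h ∈ U, φ ⟨h, hU⟩ ∈ sub (Q.tile (ψ g)) := by
      intro h hh
      obtain ⟨ha, hb⟩ := Finset.mem_sdiff.1 hh
      rw [hP] at ha
      by_cases h3 : h ∈ U
      · refine ⟨h3, ?_⟩
        rw [← ha, hψU h h3]
        exact ((mem_C _).1 (hφC ⟨h, h3⟩).1).2
      · rw [hψ h h3] at ha
        exact absurd (mem_tile_iff.2 ha) hb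
    refine Finset.card_le_card_of_injOn ψ ?_ ?_
    · intro h hh
      obtain ⟨h3, h4⟩ := key h hh
      rw [hψU h h3]; exact h4
    · intro h hh h' hh' e
      obtain ⟨h3, -⟩ := key h hh
      obtain ⟨h4, -⟩ := key h' hh'
      rw [hψU h h3, hψU h' h4] at e
      exact congrArg Subtype.val (hφ e)
  have h3 : ((bd (Q.tile (ψ g)) K).card : ℝ) < δ / 2 * (Q.tile (ψ g)).card := by
    rw [← inv_iff, ← rt_shape, inv_rt]
    exact (hA _ hg).1
  have h4 : ((bd (P.tile g) K).card : ℝ) ≤ (bd (Q.tile (ψ g)) K).card +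
      K.card * (P.tile g \ Q.tile (ψ g)).card := by exact_mod_cast card_bd_le_of_superset h1
  have h5 : ((P.tile g \ Q.tile (ψ g)).card : ℝ) ≤ b * (Q.tile (ψ g)).card :=
    (Nat.cast_le.2 h2).trans (hsub1 _)
  have h6 : ((Q.tile (ψ g)).card : ℝ) ≤ (P.tile g).card := Nat.cast_le.2 (Finset.card_le_card h1)
  have h7 : (K.card : ℝ) * (P.tile g \ Q.tile (ψ g)).card ≤ K.card * (b * (Q.tile (ψ g)).card) :=
    mul_le_mul_of_nonneg_left h5 (Nat.cast_nonneg _)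
  have h8 := mul_le_mul_of_nonneg_right hbK (Nat.cast_nonneg (α := ℝ) (Q.tile (ψ g)).card)
  have h9 := mul_le_mul_of_nonneg_left h6 hδ.le
  linarith

theorem exists_coarsen [Countable G] [Infinite G] (hG : IsAmenable G) (P : Partn G) (K : Finset G)
    {δ : ℝ} (hδ : 0 < δ) : ∃ Q : Partn G, P ≤ Q ∧ ∀ g, InvariantSet (Q.tile g) K δ := by
  obtain ⟨D, hD⟩ := P.bounded
  have h1D : (1 : G) ∈ D := by simpa using hD 1 1 (P.mem_tile 1)
  obtain ⟨L, hL⟩ : ∃ L, L = D * insert 1 K := ⟨_, rfl⟩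
  obtain ⟨V, hV⟩ := exists_exact hG L (δ := min δ 1 / 2) (by positivity)
  obtain ⟨ψ, hψ, hψ'⟩ : ∃ ψ : G → G, (∀ g, ψ g ∈ P.tile g) ∧
      ∀ g h, P.tile h = P.tile g → ψ h = ψ g := by
    have hr : ∀ t : Finset G, ∃ r, t.Nonempty → r ∈ t := fun t => by
      by_cases h : t.Nonempty
      · exact ⟨h.choose, fun _ => h.choose_spec⟩
      · exact ⟨1, fun h' => absurd h' h⟩
    choose r hr using hr
    exact ⟨fun g => r (P.tile g), fun g => hr _ ⟨g, P.mem_tile g⟩, fun g h e => by simp only [e]⟩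
  obtain ⟨Q, hQ⟩ := exists_pullback V ψ D fun g => hD g _ (hψ g)
  refine ⟨Q, fun g h hh => ?_, fun g => ?_⟩
  · rw [hQ, hψ' g h (P.tile_eq hh)]
  obtain ⟨u, hu⟩ : ∃ u, u = ψ g := ⟨_, rfl⟩
  have hQ' : ∀ h, h ∈ Q.tile g ↔ ψ h ∈ V.tile u := by
    intro h; rw [hQ, mem_tile_iff, hu]
  generalize ht : V.tile u = t at hQ'
  have hinv : ((bd t L).card : ℝ) < min δ 1 / 2 * t.card := ht ▸ inv_iff.1 (hV u)
  have hs : ∀ h, ∃ d ∈ D, ψ h = d * h := fun h => ⟨ψ h * h⁻¹, hD h _ (hψ h), by simp⟩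
  have hDL : ∀ d ∈ D, d ∈ L := fun d hd => by
    rw [hL]; simpa using Finset.mul_mem_mul hd (Finset.mem_insert_self 1 K)
  have hDKL : ∀ d ∈ D, ∀ k ∈ K, d * k ∈ L := fun d hd k hk => hL ▸
    Finset.mul_mem_mul hd (Finset.mem_insert_of_mem hk)
  have h1 : bd (Q.tile g) K ⊆ bd t L := by
    intro x hx
    obtain ⟨⟨k, hk, h1⟩, k', hk', h2⟩ := mem_bd.1 hx
    rw [hQ'] at h1 h2
    obtain ⟨d, hd, e⟩ := hs (k * x)
    obtain ⟨d', hd', e'⟩ := hs (k' * x)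
    rw [e, ← mul_assoc] at h1
    rw [e', ← mul_assoc] at h2
    exact mem_bd.2 ⟨⟨_, hDKL d hd k hk, h1⟩, _, hDKL d' hd' k' hk', h2⟩
  have h2 : t \ Q.tile g ⊆ bd t L := by
    intro x hx
    obtain ⟨hx1, hx2⟩ := Finset.mem_sdiff.1 hx
    rw [hQ'] at hx2
    obtain ⟨d, hd, e⟩ := hs x
    rw [e] at hx2
    exact mem_bd.2 ⟨⟨1, hDL 1 h1D, by rwa [one_mul]⟩, d, hDL d hd, hx2⟩
  have h3 : (t.card : ℝ) ≤ (Q.tile g).card + (bd t L).card := by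
    have : t ⊆ Q.tile g ∪ bd t L := fun x hx => by
      by_cases h : x ∈ Q.tile g
      · exact Finset.mem_union_left _ h
      · exact Finset.mem_union_right _ (h2 (Finset.mem_sdiff.2 ⟨hx, h⟩))
    exact_mod_cast (Finset.card_le_card this).trans (Finset.card_union_le _ _)
  have h4 : ((bd (Q.tile g) K).card : ℝ) ≤ (bd t L).card := Nat.cast_le.2 (Finset.card_le_card h1)
  have h5 : min δ 1 / 2 * (t.card : ℝ) ≤ 1 / 2 * t.card := by gcongr; exact min_le_right _ _
  have h6 : min δ 1 / 2 * (t.card : ℝ) ≤ δ / 2 * t.card := by gcongr; exact min_le_left _ _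
  rw [inv_iff]
  nlinarith

theorem Sat.exists_subset_card {S : Finset G} (hS : P.Sat S) {d : ℕ} (hd : ∀ g, (P.tile g).card ≤ d)
    {m : ℕ} (hm : m ≤ S.card) : ∃ Y ⊆ S, P.Sat Y ∧ m ≤ Y.card ∧ Y.card ≤ m + d := by
  induction m with
  | zero => exact ⟨∅, by simp, by simp [Sat], by simp, by simp⟩
  | succ m ih =>
    obtain ⟨Y, hY, hsat, h1, h2⟩ := ih (by omega)
    by_cases h : m + 1 ≤ Y.card
    · exact ⟨Y, hY, hsat, h, by omega⟩
    obtain ⟨g, hg, hgY⟩ : ∃ g ∈ S, g ∉ Y := by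
      by_contra! hc
      have := Finset.card_le_card hc
      omega
    have h3 := hd g
    have h4 := card_tile_pos (P := P) g
    have h5 : Disjoint Y (P.tile g) := by
      refine Finset.disjoint_left.2 fun x hx hxg => hgY (hsat x hx ?_)
      rw [P.tile_eq hxg]; exact P.mem_tile g
    refine ⟨Y ∪ P.tile g, Finset.union_subset hY (hS g hg),
      hsat.union (tile_sat (le_refl P) g), ?_, ?_⟩ <;>
    · rw [Finset.card_union_of_disjoint h5]; omega

theorem IsRigid.exists_coarsen [Countable G] [Infinite G] (hG : IsAmenable G) (hP : P.IsRigid)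
    (K : Finset G) {δ : ℝ} (hδ : 0 < δ) :
    ∃ Q : Partn G, P ≤ Q ∧ Q.IsRigid ∧ ∀ g, InvariantSet (Q.tile g) K δ := by
  obtain ⟨P₁, hP₁, hinv⟩ := Partn.exists_coarsen hG P K (δ := δ / 8) (by positivity)
  have hinv' : ∀ g, ((bd (P₁.tile g) K).card : ℝ) ≤ δ / 8 * (P₁.tile g).card :=
    fun g => (inv_iff.1 (hinv g)).le
  obtain ⟨τ, hτ⟩ : ∃ τ : ℝ, τ = min (1 / 2) (δ / (8 * (K.card + 1))) := ⟨_, rfl⟩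
  have hτ0 : 0 < τ := by rw [hτ]; positivity
  have hτ1 : τ ≤ 1 / 2 := hτ ▸ min_le_left _ _
  have hτK : K.card * τ ≤ δ / 8 := by
    have h1 : τ ≤ δ / (8 * (K.card + 1)) := hτ ▸ min_le_right _ _
    rw [le_div_iff₀ (by positivity)] at h1
    nlinarith
  obtain ⟨n, hn0, hn⟩ := hP.split hτ0
  obtain ⟨d, hd0, hd⟩ := P₁.exists_card_le
  obtain ⟨K', δ', hδ', hbig⟩ := eventually_fol.1 (eventually_le_card (G := G) (4 * n + 8 * d + 8))
  obtain ⟨P₂, hP₂, hinv₂⟩ := Partn.exists_coarsen hG P₁ K' hδ'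
  have key : ∀ S : Finset G, ∃ Y : Finset G, (∃ g, S = P₂.tile g) → Y ⊆ S ∧ P.Sat Y ∧ Rigid Y ∧
      Rigid (S \ Y) ∧ InvariantSet Y K δ ∧ InvariantSet (S \ Y) K δ := by
    intro S
    by_cases hS : ∃ g, S = P₂.tile g
    swap
    · exact ⟨∅, fun h => absurd h hS⟩
    obtain ⟨g, rfl⟩ := hS
    generalize hSe : P₂.tile g = S
    have hc : 4 * n + 8 * d + 8 ≤ S.card := hSe ▸ hbig _ (hinv₂ g)
    have hS : P₁.Sat S := hSe ▸ tile_sat hP₂ g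
    obtain ⟨Y₁, hY₁, hsat₁, h1, h2⟩ := hS.exists_subset_card hd (m := S.card / 4 + 1) (by omega)
    have hsat₂ := hS.sdiff hsat₁
    have h3 := Finset.card_sdiff_add_card_eq_card hY₁
    obtain ⟨Y', hY', hsat', hc', hr1, hr2⟩ := hn Y₁ (S \ Y₁) (hsat₁.mono hP₁) (hsat₂.mono hP₁)
      Finset.disjoint_sdiff (by omega) (Finset.card_pos.1 (by omega)) (by omega)
    have hS' : S \ Y₁ ∪ Y₁ \ Y' = S \ Y' := by
      ext x
      have := @hY₁ x
      have := @hY' x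
      simp only [Finset.mem_union, Finset.mem_sdiff]
      tauto
    rw [hS'] at hr2
    have hS'' : (S \ Y') \ (S \ Y₁) = Y₁ \ Y' := by
      ext x
      have := @hY₁ x
      simp only [Finset.mem_sdiff]
      tauto
    have hKτ : (K.card : ℝ) * (Y₁ \ Y').card ≤ δ / 8 * Y₁.card :=
      calc (K.card : ℝ) * (Y₁ \ Y').card ≤ K.card * (τ * Y₁.card) :=
            mul_le_mul_of_nonneg_left hc' (Nat.cast_nonneg _)
        _ = (K.card * τ) * Y₁.card := by ring
        _ ≤ _ := mul_le_mul_of_nonneg_right hτK (Nat.cast_nonneg _)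
    refine ⟨Y', fun _ => ⟨hY'.trans hY₁, hsat', hr1, hr2, inv_iff.2 ?_, inv_iff.2 ?_⟩⟩
    · have e1 : ((bd Y' K).card : ℝ) ≤ (bd Y₁ K).card + K.card * (Y₁ \ Y').card := by
        exact_mod_cast card_bd_le_of_subset hY'
      have e2 := hsat₁.card_bd_le fun g _ => hinv' g
      have e3 : ((Y₁ \ Y').card : ℝ) + Y'.card = Y₁.card := by
        exact_mod_cast Finset.card_sdiff_add_card_eq_card hY'
      have e4 : (0 : ℝ) < Y'.card := by exact_mod_cast Finset.card_pos.2 hr1.1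
      have e5 : τ * (Y₁.card : ℝ) ≤ 1 / 2 * Y₁.card := by gcongr
      have e6 : δ * Y₁.card ≤ δ * (2 * Y'.card) := by
        refine mul_le_mul_of_nonneg_left ?_ hδ.le
        linarith
      have e7 := mul_pos hδ e4
      linarith
    · have e1 : ((bd (S \ Y') K).card : ℝ) ≤ (bd (S \ Y₁) K).card + K.card * (Y₁ \ Y').card := by
        have := card_bd_le_of_superset (K := K) (Finset.sdiff_subset_sdiff (subset_refl S) hY')
        rw [hS''] at this
        exact_mod_cast this
      have e2 := hsat₂.card_bd_le fun g _ => hinv' g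
      have e3 : (Y₁.card : ℝ) ≤ (S \ Y₁).card := Nat.cast_le.2 (by omega)
      have e4 : ((S \ Y₁).card : ℝ) ≤ (S \ Y').card :=
        Nat.cast_le.2 (Finset.card_le_card (Finset.sdiff_subset_sdiff (subset_refl S) hY'))
      have e5 : (0 : ℝ) < (S \ Y').card := by exact_mod_cast Finset.card_pos.2 hr2.1
      have e6 := mul_le_mul_of_nonneg_left e3 hδ.le
      have e7 := mul_le_mul_of_nonneg_left e4 hδ.le
      have e8 := mul_pos hδ e5
      linarith
  choose f hf using key
  have hf' := fun g => hf (P₂.tile g) ⟨g, rfl⟩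
  obtain ⟨q, hq1, hq2⟩ : ∃ q : G → Finset G, (∀ g, g ∈ f (P₂.tile g) → q g = f (P₂.tile g)) ∧
      ∀ g, g ∉ f (P₂.tile g) → q g = P₂.tile g \ f (P₂.tile g) :=
    ⟨fun g => if g ∈ f (P₂.tile g) then f (P₂.tile g) else P₂.tile g \ f (P₂.tile g),
      fun g h => if_pos h, fun g h => if_neg h⟩
  have hsub : ∀ g, q g ⊆ P₂.tile g := by
    intro g
    by_cases h : g ∈ f (P₂.tile g)
    · rw [hq1 g h]; exact (hf' g).1
    · rw [hq2 g h]; exact Finset.sdiff_subset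
  obtain ⟨D, hD⟩ := P₂.bounded
  let Q : Partn G :=
    { tile := q
      mem_tile := fun g => by
        by_cases h : g ∈ f (P₂.tile g)
        · rwa [hq1 g h]
        · rw [hq2 g h]; exact Finset.mem_sdiff.2 ⟨P₂.mem_tile g, h⟩
      tile_eq := fun {g h} hh => by
        have e := P₂.tile_eq (hsub g hh)
        by_cases hg : g ∈ f (P₂.tile g)
        · rw [hq1 g hg] at hh ⊢
          rw [hq1 h (by rwa [e]), e]
        · rw [hq2 g hg] at hh ⊢
          rw [hq2 h (by rw [e]; exact (Finset.mem_sdiff.1 hh).2), e]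
      bounded := ⟨D, fun g h hh => hD g h (hsub g hh)⟩ }
  have hQ : Q.tile = q := rfl
  refine ⟨Q, fun g => ?_, fun g => ?_, fun g => ?_⟩ <;> rw [hQ] <;>
    obtain ⟨h1, h2, h3, h4, h5, h6⟩ := hf' g <;> by_cases h : g ∈ f (P₂.tile g)
  · rw [hq1 g h]; exact h2 g h
  · rw [hq2 g h]
    exact ((tile_sat hP₂ g).mono hP₁).sdiff h2 g (Finset.mem_sdiff.2 ⟨P₂.mem_tile g, h⟩)
  · rwa [hq1 g h]
  · rwa [hq2 g h]
  · rwa [hq1 g h]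
  · rwa [hq2 g h]

theorem IsRigid.exists_level [Countable G] [Infinite G] (hG : IsAmenable G) (hP : P.IsRigid)
    (K : Finset G) {δ η : ℝ} (hδ : 0 < δ) (hη : 0 < η) :
    ∃ Q : Partn G, P ≤ Q ∧ Q.IsRigid ∧ (∀ g, InvariantSet (Q.tile g) K δ) ∧
      ∃ (A : Finset (Finset G)) (v : Finset G → ℝ), (∀ g, Q.shape g ∈ A) ∧ (∀ S, 0 ≤ v S) ∧
        (∀ g h, h ∈ Q.tile g → v (Q.shape h) = v (Q.shape g)) ∧
        ∑ S ∈ A, Real.exp (-(v S * S.card)) ≤ 1 ∧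
        ∀ᶠ W in fol G, ∑ g ∈ W, v (Q.shape g) ≤ η * W.card := by
  obtain ⟨P₁, hP₁, hr, hinv⟩ := hP.exists_coarsen hG K hδ
  obtain ⟨A₁, hA₁⟩ : ∃ A₁ : Finset (Finset G), ∀ S, S ∈ A₁ ↔ ∃ g, P₁.shape g = S :=
    ⟨P₁.finite_range_shape.toFinset, fun S => by simp⟩
  obtain ⟨l, hl⟩ : ∃ l : ℝ, l = 2 * (A₁.card + 1) := ⟨_, rfl⟩
  have hl0 : 0 < l := by rw [hl]; positivity
  have hle : A₁.card * Real.exp (-l) ≤ 1 / 2 := by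
    have h1 : l ≤ Real.exp l := (by linarith : l ≤ l + 1).trans (Real.add_one_le_exp l)
    rw [Real.exp_neg, ← div_eq_mul_inv, div_le_iff₀ (Real.exp_pos l)]
    have : (A₁.card : ℝ) ≤ 1 / 2 * l := by rw [hl]; linarith
    linarith
  obtain ⟨Q, hQ, hQr, B, hB, hsum, hor, hev⟩ := hr.exists_iterate hG K hδ (half_pos hη)
    (a := η / (2 * l)) (by positivity) (σ := 1 / 2) (by norm_num)
  obtain ⟨v, hv1, hv2⟩ : ∃ v : Finset G → ℝ, (∀ S ∈ B, v S = η / 2) ∧ ∀ S, S ∉ B → v S = l :=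
    ⟨fun S => if S ∈ B then η / 2 else l, fun S h => if_pos h, fun S h => if_neg h⟩
  refine ⟨Q, le_trans hP₁ hQ, hQr, fun g => ?_, B ∪ A₁, v, fun g => ?_, fun S => ?_,
    fun g h hh => ?_, ?_, ?_⟩
  · rcases hor g with h | h
    · rw [← rt_shape, inv_rt]; exact (hB _ h).1
    · rw [h]; exact hinv g
  · rcases hor g with h | h
    · exact Finset.mem_union_left _ h
    · exact Finset.mem_union_right _ ((hA₁ _).2 ⟨g, by rw [shape, shape, h]⟩)
  · by_cases h : S ∈ B
    · rw [hv1 S h]; positivity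
    · rw [hv2 S h]; exact hl0.le
  · have hg : g ∈ Q.tile h := mem_tile_iff.2 (Q.tile_eq hh).symm
    by_cases h1 : Q.shape g ∈ B
    · rw [hv1 _ h1, hv1 _ (shape_mem_of_mem_tile hB h1 hh)]
    · rw [hv2 _ h1, hv2 _ fun h2 => h1 (shape_mem_of_mem_tile hB h2 hg)]
  · rw [← Finset.union_sdiff_self_eq_union, Finset.sum_union Finset.disjoint_sdiff]
    have h1 : ∑ S ∈ B, Real.exp (-(v S * S.card)) ≤ 1 / 2 := by
      refine (Finset.sum_congr rfl fun S hS => ?_).trans_le hsum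
      rw [hv1 S hS, neg_mul]
    have h2 : ∑ S ∈ A₁ \ B, Real.exp (-(v S * S.card)) ≤ 1 / 2 := by
      refine (Finset.sum_le_card_nsmul _ _ (Real.exp (-l)) fun S hS => ?_).trans ?_
      · obtain ⟨h3, h4⟩ := Finset.mem_sdiff.1 hS
        obtain ⟨g, rfl⟩ := (hA₁ S).1 h3
        rw [hv2 _ h4]
        refine Real.exp_le_exp.2 ?_
        have : (1 : ℝ) ≤ (P₁.shape g).card := by
          exact_mod_cast Finset.card_pos.2 ⟨1, one_mem_shape g⟩
        nlinarith
      · rw [nsmul_eq_mul]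
        refine _root_.le_trans (mul_le_mul_of_nonneg_right ?_ (Real.exp_pos _).le) hle
        exact Nat.cast_le.2 (Finset.card_le_card Finset.sdiff_subset)
    linarith
  · filter_upwards [hev] with W hW
    have h1 : ∀ g ∈ W, v (Q.shape g) ≤ η / 2 + if Q.shape g ∉ B then l else 0 := by
      intro g _
      by_cases h : Q.shape g ∈ B
      · rw [hv1 _ h, if_neg (not_not.2 h), add_zero]
      · rw [hv2 _ h, if_pos h]; linarith
    refine (Finset.sum_le_sum h1).trans ?_
    rw [Finset.sum_add_distrib, Finset.sum_const, nsmul_eq_mul, ← Finset.sum_filter,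
      Finset.sum_const, nsmul_eq_mul]
    have h2 := mul_le_mul_of_nonneg_right hW hl0.le
    have h3 : η / (2 * l) * W.card * l = η / 2 * W.card := by field_simp
    linarith

theorem IsRigid.exists_section (hP : P.IsRigid) :
    ∃ o : Finset G → G, ∀ g, P.shape (o (P.shape g)) = P.shape g ∧
      ∀ h ∈ P.shape g, o (rt (P.shape g) h⁻¹) = h * o (P.shape g) := by
  have hc : ∀ T : Set (Finset G), ∃ t, T.Nonempty → t ∈ T := fun T => by
    by_cases h : T.Nonempty
    · exact ⟨h.choose, fun _ => h.choose_spec⟩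
    · exact ⟨∅, fun h' => absurd h' h⟩
  choose c hc using hc
  let T : Finset G → Set (Finset G) := fun S => {t | (∃ g, rt S g = t) ∧ ∃ x, P.tile x = t}
  have hT : ∀ S h, T (rt S h) = T S := by
    intro S h
    ext t
    refine and_congr_left fun _ => ⟨?_, ?_⟩
    · rintro ⟨g, rfl⟩; exact ⟨h * g, by rw [rt_rt]⟩
    · rintro ⟨g, rfl⟩; exact ⟨h⁻¹ * g, by rw [rt_rt]; simp⟩
  have hne : ∀ g, (T (P.shape g)).Nonempty := fun g => ⟨P.tile g, ⟨g, rt_shape g⟩, g, rfl⟩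
  have ho : ∀ S, ∃ o, (T S).Nonempty → rt S o = c (T S) := fun S => by
    by_cases h : (T S).Nonempty
    · obtain ⟨⟨o, ho⟩, -⟩ := hc _ h
      exact ⟨o, fun _ => ho⟩
    · exact ⟨1, fun h' => absurd h' h⟩
  choose o ho using ho
  have hsec : ∀ g, P.shape (o (P.shape g)) = P.shape g := by
    intro g
    have h1 := ho _ (hne g)
    obtain ⟨-, x, hx⟩ := hc _ (hne g)
    rw [← hx] at h1
    have h2 : o (P.shape g) ∈ P.tile x := by rw [← h1]; simp [one_mem_shape]
    rw [shape, P.tile_eq h2, ← h1, rt_rt, mul_inv_cancel, rt_one]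
  refine ⟨o, fun g => ⟨hsec g, fun h hh => ?_⟩⟩
  have h1 := ho _ (hne g)
  have h2 := ho (rt (P.shape g) h⁻¹) (by rw [hT]; exact hne g)
  rw [hT, ← h1, rt_rt] at h2
  have hr : Rigid (P.shape g) := Rigid.translate (hP g) _
  have h3 := congrArg (fun S => rt S (o (P.shape g))⁻¹) h2
  simp only [rt_rt, mul_inv_cancel, rt_one] at h3
  have h4 := hr.2 _ h3
  rw [mul_inv_eq_one, inv_mul_eq_iff_eq_mul] at h4
  exact h4

end Partn

/-- Finite families of pointed shapes with equivariant master partitions of each level into tiles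
of the previous one, together with weights bounding the number of patterns. -/
structure Tower (G : Type*) [Group G] (η : ℕ → ℝ) where
  X : ℕ → Finset (Finset G)
  M : ℕ → Finset G → Finset G
  v : ℕ → Finset G → ℝ
  one_mem : ∀ {k S}, S ∈ X k → 1 ∈ S
  exists_tiling : ∀ k, ∃ y : G → Finset G, ∀ g, y g ∈ X k ∧ ∀ h ∈ y g, y (h * g) = rt (y g) h⁻¹
  M_mem : ∀ {k S}, S ∈ X (k + 1) → M k S ∈ X k
  M_subset : ∀ {k S}, S ∈ X (k + 1) → M k S ⊆ S
  M_rt : ∀ {k S h}, S ∈ X (k + 1) → h ∈ M k S → M k (rt S h⁻¹) = rt (M k S) h⁻¹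
  v_nonneg : ∀ k S, 0 ≤ v k S
  v_rt : ∀ {k S h}, S ∈ X k → h ∈ S → v k (rt S h⁻¹) = v k S
  kraft : ∀ k, ∑ S ∈ X k, Real.exp (-(v k S * S.card)) ≤ 1
  sum_le : ∀ {k S}, S ∈ X (k + 1) → ∑ h ∈ S, v k (M k (rt S h⁻¹)) ≤ η k * S.card

open Partn in
theorem exists_tower [Countable G] [Infinite G] (hG : IsAmenable G) {η ε : ℕ → ℝ}
    (hη : ∀ k, 0 < η k) (hε : ∀ k, 0 < ε k) (K : ℕ → Finset G) :
    ∃ T : Tower G η, ∀ k, ∀ S ∈ T.X k, InvariantSet S (K k) (ε k) := by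
  let V : ℕ → Partn G × Finset (Finset G) × (Finset G → ℝ) → Prop := fun k x =>
    x.1.IsRigid ∧ (∀ g, InvariantSet (x.1.tile g) (K k) (ε k)) ∧ (∀ g, x.1.shape g ∈ x.2.1) ∧
      (∀ S, 0 ≤ x.2.2 S) ∧ (∀ g h, h ∈ x.1.tile g → x.2.2 (x.1.shape h) = x.2.2 (x.1.shape g)) ∧
      ∑ S ∈ x.2.1, Real.exp (-(x.2.2 S * S.card)) ≤ 1 ∧
      ∀ᶠ W in fol G, ∑ g ∈ W, x.2.2 (x.1.shape g) ≤ η k * W.card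
  have h0 : ∃ x, V 0 x := by
    obtain ⟨P, -, h1, h2, A, v, h⟩ := isRigid_bot.exists_level hG (K 0) (hε 0) (hη 0)
    exact ⟨(P, A, v), h1, h2, h⟩
  have hs : ∀ k (x : {x // V k x}), ∃ y : {y // V (k + 1) y}, x.1.1 ≤ y.1.1 ∧
      ∀ g, ∑ h ∈ y.1.1.tile g, x.1.2.2 (x.1.1.shape h) ≤ η k * (y.1.1.tile g).card := by
    rintro k ⟨⟨P, A, v⟩, h1, h2, h3, h4, h5, h6, h7⟩
    obtain ⟨K', δ', hδ', hW⟩ := eventually_fol.1 h7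
    obtain ⟨Q, hQ, hr, hinv, A', v', h⟩ := h1.exists_level hG (K (k + 1) ∪ K')
      (δ := min (ε (k + 1)) δ') (lt_min (hε _) hδ') (hη (k + 1))
    exact ⟨⟨(Q, A', v'), hr, fun g => inv_mono Finset.subset_union_left (min_le_left _ _) (hinv g),
      h⟩, hQ, fun g => hW _ (inv_mono Finset.subset_union_right (min_le_right _ _) (hinv g))⟩
  choose next hnext using hs
  obtain ⟨x0, hx0⟩ := h0
  let s : (k : ℕ) → {x // V k x} := fun k => Nat.rec ⟨x0, hx0⟩ (fun k x => next k x) k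
  have hs1 : ∀ k, (s k).1.1 ≤ (s (k + 1)).1.1 := fun k => (hnext k (s k)).1
  have hs2 : ∀ k g, ∑ h ∈ (s (k + 1)).1.1.tile g, (s k).1.2.2 ((s k).1.1.shape h) ≤
    η k * ((s (k + 1)).1.1.tile g).card := fun k => (hnext k (s k)).2
  have hV := fun k => (s k).2
  clear_value s
  obtain ⟨P, hP⟩ : ∃ P : ℕ → Partn G, ∀ k, (s k).1.1 = P k := ⟨_, fun _ => rfl⟩
  obtain ⟨A, hA⟩ : ∃ A : ℕ → Finset (Finset G), ∀ k, (s k).1.2.1 = A k := ⟨_, fun _ => rfl⟩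
  obtain ⟨v, hv⟩ : ∃ v : ℕ → Finset G → ℝ, ∀ k, (s k).1.2.2 = v k := ⟨_, fun _ => rfl⟩
  simp only [V, hP, hA, hv] at hV hs1 hs2
  choose hr hinv hmem hv0 hvt hkr _ using hV
  choose o ho1 ho2 using fun k => (hr k).exists_section
  obtain ⟨X, hX⟩ : ∃ X : ℕ → Finset (Finset G), ∀ k S, S ∈ X k ↔ ∃ g, (P k).shape g = S :=
    ⟨fun k => (P k).finite_range_shape.toFinset, fun k S => by simp⟩
  have hsh : ∀ k g h, h ∈ (P k).shape g → (P k).shape (h * g) = rt ((P k).shape g) h⁻¹ := by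
    intro k g h hh
    rw [shape_of_mem (mem_shape.1 hh)]; simp
  refine ⟨⟨X, fun k S => (P k).shape (o (k + 1) S), v, ?_, ?_, ?_, ?_, ?_, hv0, ?_, ?_, ?_⟩, ?_⟩
  · intro k S hS
    obtain ⟨g, rfl⟩ := (hX k S).1 hS
    exact one_mem_shape g
  · exact fun k => ⟨(P k).shape, fun g => ⟨(hX _ _).2 ⟨g, rfl⟩, hsh k g⟩⟩
  · exact fun {k S} _ => (hX _ _).2 ⟨_, rfl⟩
  · intro k S hS
    obtain ⟨g, rfl⟩ := (hX _ S).1 hS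
    conv_rhs => rw [← ho1 (k + 1) g]
    exact rt_mono (hs1 k _) _
  · intro k S h hS hh
    obtain ⟨g, rfl⟩ := (hX _ S).1 hS
    have h1 : h ∈ (P (k + 1)).shape g := by
      rw [← ho1 (k + 1) g]
      exact rt_mono (hs1 k _) _ hh
    rw [ho2 (k + 1) g h h1, hsh k _ h hh]
  · intro k S h hS hh
    obtain ⟨g, rfl⟩ := (hX _ S).1 hS
    rw [← hsh k g h hh]
    exact hvt k _ _ (mem_shape.1 hh)
  · intro k
    refine _root_.le_trans (Finset.sum_le_sum_of_subset_of_nonneg (fun S hS => ?_)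
      fun _ _ _ => (Real.exp_pos _).le) (hkr k)
    obtain ⟨g, rfl⟩ := (hX _ S).1 hS
    exact hmem k g
  · intro k S hS
    obtain ⟨g, rfl⟩ := (hX _ S).1 hS
    have h1 := hs2 k (o (k + 1) ((P (k + 1)).shape g))
    rw [← rt_shape, ho1, card_rt] at h1
    refine _root_.le_trans (le_of_eq ?_) h1
    rw [rt, Finset.sum_map]
    refine Finset.sum_congr rfl fun h hh => ?_
    rw [ho2 (k + 1) g h hh]
    rfl
  · intro k S hS
    obtain ⟨g, rfl⟩ := (hX _ S).1 hS
    rw [shape, inv_rt]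
    exact hinv k g

theorem exists_syndetic_returns {Ω ι : Type*} [TopologicalSpace Ω] {Y : Set Ω} (hY : IsCompact Y)
    (hYc : IsClosed Y) (hne : Y.Nonempty) (σ : G → Ω → Ω) (hσ : ∀ c, Continuous (σ c))
    (hσY : ∀ c, ∀ y ∈ Y, σ c y ∈ Y) (hmul : ∀ a b y, σ a (σ b y) = σ (a * b) y)
    (U : ι → Set Ω) (hU : ∀ i, IsOpen (U i)) :
    ∃ y ∈ Y, ∀ i, (∃ g, σ g y ∈ U i) → ∃ E : Finset G, ∀ c, ∃ e ∈ E, σ (e * c) y ∈ U i := by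
  let 𝒞 : Set (Set Ω) := {C | C ⊆ Y ∧ IsClosed C ∧ C.Nonempty ∧ ∀ c, ∀ y ∈ C, σ c y ∈ C}
  obtain ⟨C, -, hC⟩ : ∃ C ⊆ Y, Minimal (· ∈ 𝒞) C := by
    refine zorn_superset_nonempty 𝒞 (fun c hc hchain hcne => ?_) Y ⟨subset_rfl, hYc, hne, hσY⟩
    obtain ⟨C₀, hC₀⟩ := hcne
    refine ⟨⋂₀ c, ⟨?_, isClosed_sInter fun t ht => (hc ht).2.1, ?_, ?_⟩,
      fun s hs => Set.sInter_subset_of_mem hs⟩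
    · exact (Set.sInter_subset_of_mem hC₀).trans (hc hC₀).1
    · have : Nonempty c := ⟨⟨C₀, hC₀⟩⟩
      exact IsCompact.nonempty_sInter_of_directed_nonempty_isCompact_isClosed
        (fun a ha b hb => (hchain.total ha hb).elim (fun h => ⟨a, ha, subset_rfl, h⟩)
          fun h => ⟨b, hb, h, subset_rfl⟩) (fun t ht => (hc ht).2.2.1)
        (fun t ht => hY.of_isClosed_subset (hc ht).2.1 (hc ht).1) fun t ht => (hc ht).2.1
    · exact fun a y hy t ht => (hc ht).2.2.2 a y (hy t ht)
  obtain ⟨hCY, hCc, ⟨y, hy⟩, hCσ⟩ := hC.1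
  refine ⟨y, hCY hy, fun i hi => ?_⟩
  by_contra! hcon
  obtain ⟨g₀, hg₀⟩ := hi
  let Z : G → Set Ω := fun g => σ g ⁻¹' (U i)ᶜ
  have hZ : ∀ g, IsClosed (Z g) := fun g => (hU i).isClosed_compl.preimage (hσ g)
  have hmem : C ∩ ⋂ g, Z g ∈ 𝒞 := by
    refine ⟨Set.inter_subset_left.trans hCY, hCc.inter (isClosed_iInter hZ), ?_, ?_⟩
    · refine (hY.of_isClosed_subset hCc hCY).inter_iInter_nonempty Z hZ fun E => ?_
      obtain ⟨c, hc⟩ := hcon E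
      refine ⟨σ c y, hCσ c y hy, Set.mem_iInter₂.2 fun e he => ?_⟩
      change σ e (σ c y) ∉ U i
      rw [hmul]
      exact hc e he
    · rintro c z ⟨hz, hz'⟩
      refine ⟨hCσ c z hz, Set.mem_iInter.2 fun g => ?_⟩
      change σ g (σ c z) ∉ U i
      rw [hmul]
      exact Set.mem_iInter.1 hz' (g * c)
  have h1 := hC.2 hmem Set.inter_subset_left hy
  exact Set.mem_iInter.1 h1.2 g₀ hg₀

namespace Tower

variable {η : ℕ → ℝ} (T : Tower G η)

/-- Tilings at level `k`, encoded by the pointed tile around each element. -/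
def IsTiling (k : ℕ) (y : G → Finset G) : Prop :=
  ∀ g, y g ∈ T.X k ∧ ∀ h ∈ y g, y (h * g) = rt (y g) h⁻¹

variable {T}

theorem IsTiling.push {k : ℕ} {y : G → Finset G} (hy : T.IsTiling (k + 1) y) :
    T.IsTiling k fun g => T.M k (y g) := by
  refine fun g => ⟨T.M_mem (hy g).1, fun h hh => ?_⟩
  beta_reduce
  rw [(hy g).2 h (T.M_subset (hy g).1 hh), T.M_rt (hy g).1 hh]

theorem IsTiling.shift {k : ℕ} {y : G → Finset G} (hy : T.IsTiling k y) (c : G) :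
    T.IsTiling k (shiftAct c y) := by
  refine fun g => ⟨(hy _).1, fun h hh => ?_⟩
  simp only [shiftAct, mul_assoc]
  exact (hy _).2 h hh

theorem IsTiling.exists_partial {m : ℕ} {z : G → Finset G} (hz : T.IsTiling m z) :
    ∃ y : ℕ → G → Finset G, (∀ k, T.IsTiling k (y k)) ∧
      (∀ k < m, ∀ g, y k g = T.M k (y (k + 1) g)) ∧ y m = z := by
  induction m generalizing z with
  | zero =>
    choose x hx using T.exists_tiling
    refine ⟨Function.update x 0 z, fun k => ?_, by simp, by simp⟩
    by_cases hk : k = 0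
    · subst hk; simpa using hz
    · rw [Function.update_of_ne hk]; exact hx k
  | succ m ih =>
    obtain ⟨y, h1, h2, h3⟩ := ih hz.push
    refine ⟨Function.update y (m + 1) z, fun k => ?_, fun k hk g => ?_, by simp⟩
    · by_cases hk : k = m + 1
      · subst hk; simpa using hz
      · rw [Function.update_of_ne hk]; exact h1 k
    · rw [Function.update_of_ne (by omega)]
      by_cases hk' : k = m
      · subst hk'
        rw [h3]; simp
      · rw [Function.update_of_ne (by omega)]
        exact h2 k (by omega) g

variable (T) in
theorem exists_minimal : ∃ y : ℕ → G → Finset G, (∀ k, T.IsTiling k (y k)) ∧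
    (∀ k g, y k g = T.M k (y (k + 1) g)) ∧
    ∀ k g, ∃ E : Finset G, ∀ c, ∃ e ∈ E, y k (e * c) = y k g := by
  let _ : TopologicalSpace (Finset G) := ⊥
  have : DiscreteTopology (Finset G) := ⟨rfl⟩
  have hev : ∀ k g, Continuous fun y : ℕ → G → Finset G => y k g := fun k g => by fun_prop
  have hcl : ∀ {s : Set (Finset G)} (k g), IsClosed {y : ℕ → G → Finset G | y k g ∈ s} :=
    fun k g => (isClosed_discrete _).preimage (hev k g)
  let Z : Set (ℕ → G → Finset G) := {y | ∀ k, T.IsTiling k (y k)}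
  have hZc : IsClosed Z := by
    have : Z = ⋂ k, ⋂ g, {y | y k g ∈ T.X k} ∩
        ⋂ h, {y | h ∈ y k g → y k (h * g) = rt (y k g) h⁻¹} := by
      ext y
      simp only [Z, IsTiling, Set.mem_iInter, Set.mem_inter_iff]
      rfl
    rw [this]
    refine isClosed_iInter fun k => isClosed_iInter fun g => IsClosed.inter (hcl (s := T.X k) k g)
      (isClosed_iInter fun h => ?_)
    exact (isClosed_discrete {p : Finset G × Finset G | h ∈ p.1 → p.2 = rt p.1 h⁻¹}).preimage
      ((hev k g).prodMk (hev k (h * g)))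
  have hZ : IsCompact Z := by
    refine IsCompact.of_isClosed_subset (isCompact_univ_pi fun k => isCompact_univ_pi fun _ : G =>
      ((T.X k).finite_toSet.isCompact)) hZc fun y hy => ?_
    exact fun k _ g _ => (hy k g).1
  let Y : ℕ → Set (ℕ → G → Finset G) := fun m => Z ∩ {y | ∀ k < m, ∀ g, y k g = T.M k (y (k + 1) g)}
  have hYc : ∀ m, IsClosed (Y m) := by
    intro m
    refine hZc.inter ?_
    have : {y : ℕ → G → Finset G | ∀ k < m, ∀ g, y k g = T.M k (y (k + 1) g)} =
        ⋂ k, ⋂ (_ : k < m), ⋂ g, {y | y k g = T.M k (y (k + 1) g)} := by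
      ext y
      simp only [Set.mem_iInter]
      rfl
    rw [this]
    refine isClosed_iInter fun k => isClosed_iInter fun _ => isClosed_iInter fun g => ?_
    exact (isClosed_discrete {p : Finset G × Finset G | p.1 = T.M k p.2}).preimage
      ((hev k g).prodMk (hev (k + 1) g))
  have hne : (⋂ m, Y m).Nonempty := by
    refine IsCompact.nonempty_iInter_of_sequence_nonempty_isCompact_isClosed Y
      (fun m y hy => ⟨hy.1, fun k hk => hy.2 k (by omega)⟩) (fun m => ?_)
      (hZ.of_isClosed_subset (hYc 0) Set.inter_subset_left) hYc
    obtain ⟨z, hz⟩ := T.exists_tiling m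
    obtain ⟨y, h1, h2, -⟩ := IsTiling.exists_partial (T := T) (m := m) (z := z) hz
    exact ⟨y, h1, h2⟩
  have hYc' := isClosed_iInter hYc
  obtain ⟨y, hy, hy'⟩ := exists_syndetic_returns
    (hZ.of_isClosed_subset hYc' ((Set.iInter_subset _ 0).trans Set.inter_subset_left)) hYc' hne
    (fun c y k => shiftAct c (y k)) (fun c => by
      refine continuous_pi fun k => continuous_pi fun g => hev k (g * c))
    (fun c y hy => Set.mem_iInter.2 fun m => ⟨fun k => ((Set.mem_iInter.1 hy m).1 k).shift c,
      fun k hk g => (Set.mem_iInter.1 hy m).2 k hk (g * c)⟩)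
    (fun a b y => by funext k g; simp [shiftAct, mul_assoc])
    (fun i : ℕ × Finset G => {y | y i.1 1 = i.2})
    (fun i => (isOpen_discrete {i.2}).preimage (hev i.1 1))
  refine ⟨y, (Set.mem_iInter.1 hy 0).1, fun k => (Set.mem_iInter.1 hy (k + 1)).2 k (by omega),
    fun k g => ?_⟩
  obtain ⟨E, hE⟩ := hy' (k, y k g) ⟨g, by simp [shiftAct]⟩
  refine ⟨E, fun c => ?_⟩
  obtain ⟨e, he, h⟩ := hE c
  exact ⟨e, he, by simpa [shiftAct] using h⟩

end Tower

/-- The partition into tiles encoded by the pointed tile around each element. -/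
def Partn.ofPointed {X : Finset (Finset G)} (hX : ∀ S ∈ X, (1 : G) ∈ S) {y : G → Finset G}
    (hy : ∀ g, y g ∈ X ∧ ∀ h ∈ y g, y (h * g) = rt (y g) h⁻¹) : Partn G where
  tile g := rt (y g) g
  mem_tile g := by simpa using hX _ (hy g).1
  tile_eq {g h} hh := by
    have := (hy g).2 _ (mem_rt.1 hh)
    rw [inv_mul_cancel_right] at this
    rw [this, rt_rt]
    simp
  bounded := ⟨X.biUnion id, fun g h hh => Finset.mem_biUnion.2 ⟨_, (hy g).1, mem_rt.1 hh⟩⟩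

/-- Restriction of a configuration to `F`. -/
noncomputable def restr (F : Finset G) (y : G → Finset G) : G → Finset G :=
  fun g => if g ∈ F then y g else ∅

theorem restr_image_ncard_le_exp {X : Finset (Finset G)} (hX : ∀ S ∈ X, (1 : G) ∈ S)
    {v : Finset G → ℝ} (hvr : ∀ S ∈ X, ∀ h ∈ S, v (rt S h⁻¹) = v S)
    (hk : ∑ S ∈ X, Real.exp (-(v S * S.card)) ≤ 1) (F : Finset G) (L : ℝ)
    (Y : Set (G → Finset G)) (hY : ∀ y ∈ Y, ∀ g, y g ∈ X ∧ ∀ h ∈ y g, y (h * g) = rt (y g) h⁻¹)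
    (hL : ∀ y ∈ Y, ∑ h ∈ F.biUnion fun g => rt (y g) g, v (y h) ≤ L) :
    (restr F '' Y).Finite ∧ ((restr F '' Y).ncard : ℝ) ≤ Real.exp L := by
  induction F using Finset.strongInduction generalizing L Y with
  | H F ih =>
  rcases F.eq_empty_or_nonempty with rfl | ⟨g, hg⟩
  · have h1 : restr ∅ '' Y ⊆ {fun _ : G => (∅ : Finset G)} := by
      rintro _ ⟨y, -, rfl⟩
      funext g; simp [restr]
    refine ⟨(Set.finite_singleton _).subset h1, ?_⟩
    rcases Y.eq_empty_or_nonempty with rfl | ⟨y, hy⟩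
    · simp [Real.exp_nonneg]
    · have h2 := Set.ncard_le_ncard h1
      rw [Set.ncard_singleton] at h2
      have h3 := hL y hy
      simp only [Finset.biUnion_empty, Finset.sum_empty] at h3
      exact (Nat.cast_le.2 h2).trans (by simpa using h3)
  let Z : Finset G → Set (G → Finset G) := fun S => {y ∈ Y | y g = S}
  have hZ : ∀ S ∈ X, (restr F '' Z S).Finite ∧
      ((restr F '' Z S).ncard : ℝ) ≤ Real.exp L * Real.exp (-(v S * S.card)) := by
    intro S hS
    have hsub : F \ rt S g ⊂ F := by
      refine ⟨Finset.sdiff_subset, fun h => (Finset.mem_sdiff.1 (h hg)).2 ?_⟩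
      simpa using hX S hS
    obtain ⟨h1, h2⟩ := ih _ hsub (L - v S * S.card) (Z S) (fun y hy => hY y hy.1) (by
      rintro y ⟨hy, hyg⟩
      let P := Partn.ofPointed hX (hY y hy)
      have hP : ∀ x, rt (y x) x = P.tile x := fun _ => rfl
      have e1 : P.tile g = rt S g := by rw [← hP, hyg]
      have e2 : (F.biUnion fun g => rt (y g) g) =
          P.tile g ∪ (F \ rt S g).biUnion fun g => rt (y g) g := by
        ext x
        simp only [Finset.mem_biUnion, Finset.mem_union, hP, ← e1, Finset.mem_sdiff]
        constructor
        · rintro ⟨a, ha, hx⟩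
          by_cases h : a ∈ P.tile g
          · exact Or.inl (P.tile_eq h ▸ hx)
          · exact Or.inr ⟨a, ⟨ha, h⟩, hx⟩
        · rintro (h | ⟨a, ⟨ha, -⟩, hx⟩)
          exacts [⟨g, hg, h⟩, ⟨a, ha, hx⟩]
      have e3 : Disjoint (P.tile g) ((F \ rt S g).biUnion fun g => rt (y g) g) := by
        refine Finset.disjoint_left.2 fun x hx hx' => ?_
        obtain ⟨a, ha, hxa⟩ := Finset.mem_biUnion.1 hx'
        refine (Finset.mem_sdiff.1 ha).2 ?_
        rw [← e1, Partn.mem_tile_iff, ← P.tile_eq hx, P.tile_eq (g := a) hxa]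
      have e4 := hL y hy
      rw [e2, Finset.sum_union e3] at e4
      have e5 : ∑ h ∈ P.tile g, v (y h) = v S * S.card := by
        rw [e1, rt, Finset.sum_map, Finset.sum_congr rfl (g := fun _ => v S), Finset.sum_const,
          nsmul_eq_mul, mul_comm]
        intro h hh
        have := (hY y hy g).2 h (by rwa [hyg])
        rw [mulRightEmbedding_apply, this, hyg]
        exact hvr S hS h hh
      linarith)
    let f : (G → Finset G) → G → Finset G := fun z x =>
      if x ∈ F ∧ x ∈ rt S g then rt S (g * x⁻¹) else z x
    have h3 : restr F '' Z S = f '' (restr (F \ rt S g) '' Z S) := by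
      rw [Set.image_image]
      refine Set.image_congr ?_
      rintro y ⟨hy, hyg⟩
      funext x
      by_cases hx : x ∈ F <;> by_cases hx' : x ∈ rt S g
      · have := (hY y hy g).2 (x * g⁻¹) (by rw [hyg]; exact mem_rt.1 hx')
        rw [inv_mul_cancel_right, hyg, mul_inv_rev, inv_inv] at this
        simp only [restr, f, hx, hx', if_true, and_self, this]
      all_goals simp only [restr, f, hx, hx', if_true, if_false, and_true, and_false,
        Finset.mem_sdiff, not_true, not_false_eq_true]
    rw [h3]
    refine ⟨h1.image f, (Nat.cast_le.2 (Set.ncard_image_le h1)).trans ?_⟩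
    rw [← Real.exp_add]
    exact h2
  have hU : restr F '' Y = ⋃ S ∈ X, restr F '' Z S := by
    ext z
    simp only [Set.mem_iUnion, Set.mem_image]
    constructor
    · rintro ⟨y, hy, rfl⟩
      exact ⟨y g, (hY y hy g).1, y, ⟨hy, rfl⟩, rfl⟩
    · rintro ⟨S, -, y, hy, rfl⟩
      exact ⟨y, hy.1, rfl⟩
  rw [hU]
  refine ⟨X.finite_toSet.biUnion fun S hS => (hZ S hS).1, ?_⟩
  calc ((⋃ S ∈ X, restr F '' Z S).ncard : ℝ) ≤ ∑ S ∈ X, ((restr F '' Z S).ncard : ℝ) := by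
        exact_mod_cast Finset.set_ncard_biUnion_le _ _
    _ ≤ ∑ S ∈ X, Real.exp L * Real.exp (-(v S * S.card)) :=
      Finset.sum_le_sum fun S hS => (hZ S hS).2
    _ ≤ Real.exp L * 1 := by
        rw [← Finset.mul_sum]
        exact mul_le_mul_of_nonneg_left hk (Real.exp_nonneg _)
    _ = _ := mul_one _

namespace Tower

variable {η : ℕ → ℝ} {T : Tower G η} {y : ℕ → G → Finset G}

theorem IsTiling.cost_le {k : ℕ} (hη : 0 ≤ η k) {y : G → Finset G} (hy : T.IsTiling (k + 1) y)
    (F : Finset G) :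
    ∑ h ∈ F.biUnion fun g => rt (T.M k (y g)) g, T.v k (T.M k (y h)) ≤
      η k * ((T.X (k + 1)).biUnion id * F).card := by
  let P := Partn.ofPointed (X := T.X (k + 1)) (fun S hS => T.one_mem hS) hy
  have hP : ∀ x, P.tile x = rt (y x) x := fun _ => rfl
  set B := F.biUnion fun g => P.tile g with hB
  have hBs : P.Sat B := Partn.Sat.biUnion fun g _ => Partn.tile_sat (Partn.le_refl P) g
  have h1 : (F.biUnion fun g => rt (T.M k (y g)) g) ⊆ B :=
    Finset.biUnion_mono fun g _ => rt_mono (T.M_subset (hy g).1) g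
  have h2 : B ⊆ (T.X (k + 1)).biUnion id * F := by
    intro x hx
    obtain ⟨g, hg, hxg⟩ := Finset.mem_biUnion.1 hx
    rw [hP, mem_rt] at hxg
    exact Finset.mem_mul.2 ⟨x * g⁻¹, Finset.mem_biUnion.2 ⟨_, (hy g).1, hxg⟩, g, hg, by simp⟩
  have h3 := hBs.sum_nonneg (f := fun h => η k - T.v k (T.M k (y h))) fun g _ => by
    rw [Finset.sum_sub_distrib, Finset.sum_const, nsmul_eq_mul, hP, card_rt, rt, Finset.sum_map]
    have := T.sum_le (hy g).1
    rw [Finset.sum_congr rfl fun h hh => by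
      rw [mulRightEmbedding_apply, (hy g).2 h hh]]
    linarith
  rw [Finset.sum_sub_distrib, Finset.sum_const, nsmul_eq_mul] at h3
  calc _ ≤ ∑ h ∈ B, T.v k (T.M k (y h)) :=
        Finset.sum_le_sum_of_subset_of_nonneg h1 fun _ _ _ => T.v_nonneg _ _
    _ ≤ η k * B.card := by linarith
    _ ≤ _ := mul_le_mul_of_nonneg_left (Nat.cast_le.2 (Finset.card_le_card h2)) hη

theorem eventually_ncard_le (hη : ∀ k, 0 < η k) (hy : ∀ k, T.IsTiling k (y k))
    (hM : ∀ k g, y k g = T.M k (y (k + 1) g)) (k : ℕ) :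
    ∀ᶠ F in fol G, (restr F '' Set.range fun c => shiftAct c (y k)).Finite ∧
      ((restr F '' Set.range fun c => shiftAct c (y k)).ncard : ℝ) ≤
        Real.exp (2 * η k * F.card) := by
  filter_upwards [eventually_card_mul_le ((T.X (k + 1)).biUnion id) one_pos] with F hF
  refine restr_image_ncard_le_exp (fun S hS => T.one_mem hS) (fun S hS h hh => T.v_rt hS hh)
    (T.kraft k) F _ _ ?_ ?_
  · rintro _ ⟨c, rfl⟩
    exact (hy k).shift c
  · rintro _ ⟨c, rfl⟩
    have h1 := ((hy (k + 1)).shift c).cost_le (hη k).le F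
    have h2 : ∀ g, shiftAct c (y k) g = T.M k (shiftAct c (y (k + 1)) g) := fun g => hM k _
    simp only [h2]
    refine h1.trans ((mul_le_mul_of_nonneg_left hF (hη k).le).trans (le_of_eq (by ring)))

theorem exists_factor (hM : ∀ k g, y k g = T.M k (y (k + 1) g)) {j k : ℕ} (hjk : j ≤ k) :
    ∃ f : Finset G → Finset G, ∀ g, y j g = f (y k g) := by
  induction k, hjk using Nat.le_induction with
  | base => exact ⟨id, fun _ => rfl⟩
  | succ k _ ih =>
    obtain ⟨f, hf⟩ := ih
    exact ⟨f ∘ T.M k, fun g => by rw [hf, hM]; rfl⟩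

theorem eventually_ncard_le_exp (hη : ∀ k, 0 < η k) (hη0 : Tendsto η atTop (𝓝 0))
    (hy : ∀ k, T.IsTiling k (y k)) (hM : ∀ k g, y k g = T.M k (y (k + 1) g)) (j : ℕ) {δ : ℝ}
    (hδ : 0 < δ) :
    ∀ᶠ F in fol G, (restr F '' Set.range fun c => shiftAct c (y j)).Finite ∧
      ((restr F '' Set.range fun c => shiftAct c (y j)).ncard : ℝ) ≤ Real.exp (δ * F.card) := by
  obtain ⟨k, hk, hjk⟩ :=
    ((hη0.eventually_lt_const (half_pos hδ)).and (eventually_ge_atTop j)).exists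
  obtain ⟨f, hf⟩ := exists_factor hM hjk
  filter_upwards [eventually_ncard_le hη hy hM k] with F hF
  have h1 : (restr F '' Set.range fun c => shiftAct c (y j)) =
      (fun z g => if g ∈ F then f (z g) else ∅) ''
        (restr F '' Set.range fun c => shiftAct c (y k)) := by
    simp only [← Set.range_comp]
    congr 1
    funext c g
    by_cases hg : g ∈ F <;> simp [restr, hg, shiftAct, hf]
  rw [h1]
  refine ⟨hF.1.image _, (Nat.cast_le.2 (Set.ncard_image_le hF.1)).trans (hF.2.trans ?_)⟩
  refine Real.exp_le_exp.2 (mul_le_mul_of_nonneg_right ?_ (Nat.cast_nonneg _))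
  linarith

end Tower

theorem patternCount_le {y : G → Finset G} {F : Finset G}
    (hF : (restr F '' Set.range fun c => shiftAct c y).Finite) :
    patternCount (closure (Set.range fun c => shiftAct c fun g => some (y g))) F ≤
      (restr F '' Set.range fun c => shiftAct c y).ncard := by
  have : DiscreteTopology (Option (Finset G)) := ⟨rfl⟩
  refine (Set.ncard_le_ncard (t := (fun (z : G → Finset G) (g : F) => some (z g)) ''
    (restr F '' Set.range fun c => shiftAct c y)) ?_ (hF.image _)).trans (Set.ncard_image_le hF)
  rintro p ⟨x, hx, hp⟩
  have hopen : IsOpen (Set.pi (F : Set G) fun g => {x g}) :=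
    isOpen_set_pi F.finite_toSet fun g _ => isOpen_discrete _
  obtain ⟨_, h1, c, rfl⟩ := mem_closure_iff.1 hx _ hopen fun g _ => rfl
  refine ⟨_, ⟨_, ⟨c, rfl⟩, rfl⟩, ?_⟩
  funext g
  rw [← hp, ← h1 g g.2]
  simp [restr, shiftAct]

namespace Tower

variable {η : ℕ → ℝ} {T : Tower G η}

namespace IsTiling

variable {k : ℕ} {y : G → Finset G}

theorem rt_eq_of_mem (hy : T.IsTiling k y) {g h : G} (hh : h ∈ rt (y g) g) :
    rt (y h) h = rt (y g) g :=
  (Partn.ofPointed (X := T.X k) (fun _ hS => T.one_mem hS) hy).tile_eq hh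

theorem self_mem (hy : T.IsTiling k y) (g : G) : g ∈ rt (y g) g := by simpa using T.one_mem (hy g).1

variable (hy : T.IsTiling k y)

/-- The finite tiling encoded by `y`. -/
noncomputable def toFiniteTiling : FiniteTiling G where
  tiles := Set.range fun g => (rt (y g) g : Set G)
  shapes := (T.X k).filter fun S => ∃ g, y g = S
  covers g := by
    refine ⟨rt (y g) g, ⟨⟨g, rfl⟩, Finset.mem_coe.2 (hy.self_mem g)⟩, ?_⟩
    rintro _ ⟨⟨h, rfl⟩, hg⟩
    exact congrArg _ (hy.rt_eq_of_mem (Finset.mem_coe.1 hg)).symm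
  tile_shape := by
    rintro _ ⟨g, rfl⟩
    exact ⟨y g, Finset.mem_filter.2 ⟨(hy g).1, g, rfl⟩, g, coe_rt _ _⟩
  one_mem_shape S hS := T.one_mem (Finset.mem_filter.1 hS).1

theorem mem_shapes {S : Finset G} : S ∈ hy.toFiniteTiling.shapes ↔ ∃ g, y g = S := by
  refine Finset.mem_filter.trans ⟨fun h => h.2, fun h => ⟨?_, h⟩⟩
  obtain ⟨g, rfl⟩ := h
  exact (hy g).1

theorem mem_center {S : Finset G} (hS : S ∈ hy.toFiniteTiling.shapes) {c : G} :
    c ∈ hy.toFiniteTiling.center S ↔ y c = S := by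
  constructor
  · rintro ⟨g, hg⟩
    rw [← coe_rt] at hg
    have h1 := Finset.coe_injective hg
    have h2 : c ∈ rt (y g) g := by
      rw [h1]; simpa using hy.toFiniteTiling.one_mem_shape S hS
    rw [← hy.rt_eq_of_mem h2] at h1
    exact rt_injective c h1
  · rintro rfl
    exact ⟨c, coe_rt _ _⟩

theorem point_toFiniteTiling : hy.toFiniteTiling.point = fun g => some (y g) := by
  funext g
  have hS := hy.mem_shapes.2 ⟨g, rfl⟩
  have h : ∃ S, S ∈ hy.toFiniteTiling.shapes ∧ g ∈ hy.toFiniteTiling.center S :=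
    ⟨y g, hS, (hy.mem_center hS).2 rfl⟩
  rw [FiniteTiling.point, dif_pos h, (hy.mem_center h.choose_spec.1).1 h.choose_spec.2]

theorem isIrreducible_toFiniteTiling
    (h : ∀ g, ∃ E : Finset G, ∀ c, ∃ e ∈ E, y (e * c) = y g) :
    hy.toFiniteTiling.IsIrreducible := by
  have h' : ∀ S, ∃ E : Finset G, S ∈ hy.toFiniteTiling.shapes → ∀ c, ∃ e ∈ E, y (e * c) = S := by
    intro S
    by_cases hS : S ∈ hy.toFiniteTiling.shapes
    · obtain ⟨g, rfl⟩ := hy.mem_shapes.1 hS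
      obtain ⟨E, hE⟩ := h g
      exact ⟨E, fun _ => hE⟩
    · exact ⟨∅, fun hS' => absurd hS' hS⟩
  choose E hE using h'
  refine ⟨insert 1 (hy.toFiniteTiling.shapes.biUnion fun S => S * E S), 1, one_pos,
    fun F hF S hS => ?_⟩
  rw [inv_iff, one_mul, Nat.cast_lt] at hF
  obtain ⟨g, hg, hgb⟩ := Finset.exists_mem_notMem_of_card_lt_card hF
  obtain ⟨e, he, hey⟩ := hE S hS g
  refine ⟨e * g, (hy.mem_center hS).2 hey, ?_⟩
  rw [← coe_rt, Finset.coe_subset]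
  intro x hx
  by_contra hxF
  refine hgb (mem_bd.2 ⟨⟨1, Finset.mem_insert_self _ _, by rwa [one_mul]⟩, x * g⁻¹, ?_, by simpa⟩)
  refine Finset.mem_insert_of_mem (Finset.mem_biUnion.2 ⟨S, hS, Finset.mem_mul.2
    ⟨_, mem_rt.1 hx, e, he, by group⟩⟩)

end IsTiling

theorem primelyCongruent {k : ℕ} {x y : G → Finset G} (hx : T.IsTiling k x)
    (hy : T.IsTiling (k + 1) y) (h : ∀ g, x g = T.M k (y g)) :
    PrimelyCongruent hx.toFiniteTiling hy.toFiniteTiling := by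
  have hsub : ∀ g, rt (x g) g ⊆ rt (y g) g := fun g => by
    rw [h]; exact rt_mono (T.M_subset (hy g).1) g
  refine ⟨?_, fun S hS c c' hc hc' => ?_⟩
  · rintro _ ⟨a, rfl⟩ _ ⟨b, rfl⟩ ⟨g, ha, hb⟩
    beta_reduce
    rw [← hx.rt_eq_of_mem (Finset.mem_coe.1 ha), ← hy.rt_eq_of_mem (Finset.mem_coe.1 hb)]
    exact Finset.coe_subset.2 (hsub g)
  · have key : ∀ c, c ∈ hy.toFiniteTiling.center S →
        {u : Set G | ∃ t ∈ hx.toFiniteTiling.tiles, t ⊆ (S : Set G) * {c} ∧ u = t * {c⁻¹}} =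
          {u : Set G | ∃ a ∈ S, u = rt (T.M k (rt S a⁻¹)) a} := by
      intro c hc
      have hyc := (hy.mem_center hS).1 hc
      have hya : ∀ a ∈ S, x (a * c) = T.M k (rt S a⁻¹) := fun a ha => by
        rw [h, (hy c).2 a (by rwa [hyc]), hyc]
      ext u
      constructor
      · rintro ⟨_, ⟨g, rfl⟩, ht, rfl⟩
        beta_reduce at ht ⊢
        rw [← coe_rt, Finset.coe_subset] at ht
        have hg := mem_rt.1 (ht (hx.self_mem g))
        refine ⟨g * c⁻¹, hg, ?_⟩
        rw [← coe_rt, rt_rt, ← hya _ hg, inv_mul_cancel_right]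
      · rintro ⟨a, ha, rfl⟩
        refine ⟨_, ⟨a * c, rfl⟩, ?_, ?_⟩
        · beta_reduce
          rw [← coe_rt, Finset.coe_subset]
          refine (hsub _).trans (subset_of_eq ?_)
          rw [hy.rt_eq_of_mem (g := c) (by rw [hyc]; simpa using ha), hyc]
        · beta_reduce
          rw [← coe_rt, rt_rt, hya a ha, mul_inv_cancel_right]
    rw [key c hc, key c' hc']

end Tower

end GroupTiling

/-- Existence of a primely congruent sequence of finite
irreducible tilings with prescribed invariance of shapes and zero topological
entropy of the associated subshifts. -/
theorem exists_primely_congruent_irreducible_tilings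
    {G : Type*} [Group G] [Countable G] [Infinite G] (hG : IsAmenable G)
    (ε : ℕ → ℝ) (hε : ∀ k, 0 < ε k) (hε0 : Filter.Tendsto ε Filter.atTop (nhds 0))
    (K : ℕ → Finset G) :
    ∃ T : ℕ → FiniteTiling G,
      (∀ k, PrimelyCongruent (T k) (T (k + 1))) ∧
      (∀ k, (T k).IsIrreducible) ∧
      (∀ k, ∀ S ∈ (T k).shapes, InvariantSet S (K k) (ε k)) ∧
      (∀ k, ∀ Fo : ℕ → Finset G, IsFolnerSeq G Fo →
        Filter.Tendsto
          (fun n => Real.log (patternCount (T k).subshift (Fo n)) / (Fo n).card)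
          Filter.atTop (nhds 0)) := by
  let η : ℕ → ℝ := fun k => 1 / ((k : ℝ) + 1)
  have hη : ∀ k, 0 < η k := fun k => by positivity
  obtain ⟨T, hT⟩ := GroupTiling.exists_tower hG hη hε K
  obtain ⟨y, hy, hM, hmin⟩ := T.exists_minimal
  refine ⟨fun k => (hy k).toFiniteTiling, fun k => GroupTiling.Tower.primelyCongruent _ _ (hM k),
    fun k => (hy k).isIrreducible_toFiniteTiling (hmin k), fun k S hS => ?_, fun k Fo hFo => ?_⟩
  · obtain ⟨g, rfl⟩ := (hy k).mem_shapes.1 hS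
    exact hT k _ ((hy k) g).1
  · refine Metric.tendsto_nhds.2 fun δ hδ => ?_
    filter_upwards [(GroupTiling.tendsto_fol hFo).eventually
      (GroupTiling.Tower.eventually_ncard_le_exp hη
        tendsto_one_div_add_atTop_nhds_zero_nat hy hM k (half_pos hδ))] with n ⟨h1, h2⟩
    have hc : (0 : ℝ) < (Fo n).card := by exact_mod_cast (hFo.1 n).card_pos
    have h3 : ((patternCount (hy k).toFiniteTiling.subshift (Fo n) : ℕ) : ℝ) ≤
        Real.exp (δ / 2 * (Fo n).card) := by
      rw [FiniteTiling.subshift, (hy k).point_toFiniteTiling]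
      exact (Nat.cast_le.2 (GroupTiling.patternCount_le h1)).trans h2
    have h4 := Real.log_natCast_nonneg (patternCount (hy k).toFiniteTiling.subshift (Fo n))
    have h5 : Real.log (patternCount (hy k).toFiniteTiling.subshift (Fo n)) ≤
        δ / 2 * (Fo n).card := by
      rcases Nat.eq_zero_or_pos (patternCount (hy k).toFiniteTiling.subshift (Fo n)) with h | h
      · rw [h]; simp only [Nat.cast_zero, Real.log_zero]; exact (mul_pos (half_pos hδ) hc).le
      · rw [Real.log_le_iff_le_exp (by exact_mod_cast h)]; exact h3
    rw [Real.dist_eq, sub_zero, abs_of_nonneg (div_nonneg h4 hc.le), div_lt_iff₀ hc]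
    nlinarith
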